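/- Let Γ_t, t ∈ [α, β), be a smooth solution of the Yang–Mills flow on the trivial bundle ℝⁿ × ℝᵐ with metric-compatible values, such that for every compact subinterval J ⊆ [α, β) there is a polynomial p with |F_t(x)| + Σ_{i,j,k} ‖∇ᵢ(F_t)_{jk}(x)‖ + Σ_{i,j,k,l} ‖∇ᵢ∇ⱼ(F_t)_{kl}(x)‖ ≤ p(|x|) for all t ∈ J and x ∈ ℝⁿ. Fix x₀ ∈ ℝⁿ and t₀ ∈ (α, β]. Then the function t ↦ (t₀ − t)² (4π(t₀ − t))^{−n/2} ∫_{ℝⁿ} |F_t(x)|² e^{−|x−x₀|²/(4(t₀−t))} dx is nonincreasing in t on [α, t₀) ∩ [α, β). -/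

import Mathlib

open MeasureTheory Real Filter Matrix
open scoped ENNReal

noncomputable section

namespace YM

variable {n m : ℕ}

/-- A connection on the trivial bundle `ℝⁿ × ℝᵐ`, given by its coefficient
matrices `Γ₁(x), …, Γₙ(x)`. -/
abbrev Conn (n m : ℕ) :=
  (Fin n → ℝ) → Fin n → Matrix (Fin m) (Fin m) ℝ

/-- Entrywise `i`-th partial derivative of a matrix-valued map on `ℝⁿ`. -/
def pder (i : Fin n) (A : (Fin n → ℝ) → Matrix (Fin m) (Fin m) ℝ)
    (x : Fin n → ℝ) : Matrix (Fin m) (Fin m) ℝ :=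
  Matrix.of fun a b => fderiv ℝ (fun y => A y a b) x (Pi.single i 1)

/-- Smoothness (entrywise) of a matrix-valued map on `ℝⁿ`. -/
def SmoothMat (A : (Fin n → ℝ) → Matrix (Fin m) (Fin m) ℝ) : Prop :=
  ∀ a b, ContDiff ℝ (⊤ : ℕ∞) fun y => A y a b

/-- Smoothness of a connection. -/
def Smooth (Γ : Conn n m) : Prop :=
  ∀ i, SmoothMat fun x => Γ x i

/-- Matrix commutator. -/
def comm (A B : Matrix (Fin m) (Fin m) ℝ) : Matrix (Fin m) (Fin m) ℝ :=
  A * B - B * A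

/-- Curvature `F_{ij} = ∂ᵢΓⱼ − ∂ⱼΓᵢ + [Γᵢ, Γⱼ]`. -/
def curv (Γ : Conn n m) (i j : Fin n) (x : Fin n → ℝ) :
    Matrix (Fin m) (Fin m) ℝ :=
  pder i (fun y => Γ y j) x - pder j (fun y => Γ y i) x + comm (Γ x i) (Γ x j)

/-- Covariant derivative `∇ᵢA = ∂ᵢA + [Γᵢ, A]`. -/
def covDer (Γ : Conn n m) (i : Fin n)
    (A : (Fin n → ℝ) → Matrix (Fin m) (Fin m) ℝ) (x : Fin n → ℝ) :
    Matrix (Fin m) (Fin m) ℝ :=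
  pder i A x + comm (Γ x i) (A x)

/-- `(D*F)ₖ = −Σᵢ ∇ᵢF_{ik}`. -/
def dstarF (Γ : Conn n m) (k : Fin n) (x : Fin n → ℝ) :
    Matrix (Fin m) (Fin m) ℝ :=
  - ∑ i, covDer Γ i (fun y => curv Γ i k y) x

/-- Squared Frobenius norm of a matrix. -/
def frobSq (A : Matrix (Fin m) (Fin m) ℝ) : ℝ := ∑ a, ∑ b, (A a b) ^ 2

/-- Frobenius norm of a matrix. -/
def frobNorm (A : Matrix (Fin m) (Fin m) ℝ) : ℝ := Real.sqrt (frobSq A)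

/-- Frobenius inner product `⟨A, B⟩ = tr(A Bᵀ)`. -/
def frobInner (A B : Matrix (Fin m) (Fin m) ℝ) : ℝ := ∑ a, ∑ b, A a b * B a b

/-- `|F(x)|² = Σ_{i,j} ‖F_{ij}(x)‖²` (Frobenius norms). -/
def normSqF (Γ : Conn n m) (x : Fin n → ℝ) : ℝ :=
  ∑ i, ∑ j, frobSq (curv Γ i j x)

/-- `|F(x)|`. -/
def normF (Γ : Conn n m) (x : Fin n → ℝ) : ℝ := Real.sqrt (normSqF Γ x)

/-- Euclidean norm on `ℝⁿ`. -/
def enorm (x : Fin n → ℝ) : ℝ := Real.sqrt (∑ i, x i ^ 2)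

/-- Metric compatibility: all coefficient matrices are skew-symmetric. -/
def MetricCompat (Γ : Conn n m) : Prop :=
  ∀ x i, (Γ x i)ᵀ = -(Γ x i)

/-- `(x₀,t₀)`-soliton: `Σᵢ ∇ᵢF_{ik} = (1/(2t₀)) Σᵢ (x−x₀)ᵢ F_{ik}`. -/
def IsSolitonAt (Γ : Conn n m) (x₀ : Fin n → ℝ) (t₀ : ℝ) : Prop :=
  ∀ (x : Fin n → ℝ) (k : Fin n),
    ∑ i, covDer Γ i (fun y => curv Γ i k y) x
      = (1 / (2 * t₀)) • ∑ i, (x i - x₀ i) • curv Γ i k x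

/-- `(0,1)`-soliton. -/
def IsSoliton (Γ : Conn n m) : Prop := IsSolitonAt Γ 0 1

/-- The `ℱ`-functional
`ℱ_{x₀,t₀}(Γ) = t₀² (4πt₀)^{−n/2} ∫ |F|² e^{−|x−x₀|²/(4t₀)}`. -/
def Ffunc (Γ : Conn n m) (x₀ : Fin n → ℝ) (t₀ : ℝ) : ℝ :=
  t₀ ^ 2 * (4 * π * t₀) ^ (-(n : ℝ) / 2) *
    ∫ x : Fin n → ℝ,
      normSqF Γ x * Real.exp (-(∑ i, (x i - x₀ i) ^ 2) / (4 * t₀))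

/-- The entropy `λ(Γ) = sup_{x₀, t₀>0} ℱ_{x₀,t₀}(Γ)`, valued in `[0,∞]`. -/
def entropy (Γ : Conn n m) : ℝ≥0∞ :=
  ⨆ (x₀ : Fin n → ℝ) (t₀ : ℝ) (_ : 0 < t₀), ENNReal.ofReal (Ffunc Γ x₀ t₀)

/-- Polynomial curvature growth: `|F(x)| ≤ p(|x|)`. -/
def PolyCurvGrowth (Γ : Conn n m) : Prop :=
  ∃ p : Polynomial ℝ, ∀ x, normF Γ x ≤ p.eval (enorm x)

/-- Polynomial curvature growth to order two. -/
def PolyCurvGrowth2 (Γ : Conn n m) : Prop :=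
  ∃ p : Polynomial ℝ, ∀ x,
    normF Γ x
      + (∑ i, ∑ j, ∑ k, frobNorm (covDer Γ i (fun y => curv Γ j k y) x))
      + (∑ i, ∑ j, ∑ k, ∑ l,
          frobNorm (covDer Γ i
            (fun y => covDer Γ j (fun z => curv Γ k l z) y) x))
      ≤ p.eval (enorm x)

/-- Cylindrical: some nonzero constant vector `V` satisfies `V ⌟ F ≡ 0`. -/
def Cylindrical (Γ : Conn n m) : Prop :=
  ∃ V : Fin n → ℝ, V ≠ 0 ∧
    ∀ (x : Fin n → ℝ) (k : Fin n), ∑ i, V i • curv Γ i k x = 0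

/-- `(DB)_{ij} = ∇ᵢBⱼ − ∇ⱼBᵢ`. -/
def Dop (Γ B : Conn n m) (i j : Fin n) (x : Fin n → ℝ) :
    Matrix (Fin m) (Fin m) ℝ :=
  covDer Γ i (fun y => B y j) x - covDer Γ j (fun y => B y i) x

/-- The second variation operator
`(L_{x₀,t₀}B)ₖ = −Σᵢ∇ᵢ(DB)_{ik} + (1/(2t₀))Σᵢ(x−x₀)ᵢ(DB)_{ik} + Σᵢ[Bᵢ,F_{ik}]`. -/
def Lop (Γ B : Conn n m) (x₀ : Fin n → ℝ) (t₀ : ℝ) (k : Fin n)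
    (x : Fin n → ℝ) : Matrix (Fin m) (Fin m) ℝ :=
  (- ∑ i, covDer Γ i (fun y => Dop Γ B i k y) x)
    + (1 / (2 * t₀)) • ∑ i, (x i - x₀ i) • Dop Γ B i k x
    + ∑ i, comm (B x i) (curv Γ i k x)

/-- The Gaussian weight `G(x) = (4π)^{−n/2} e^{−|x|²/4}`. -/
def gaussG (n : ℕ) (x : Fin n → ℝ) : ℝ :=
  (4 * π) ^ (-(n : ℝ) / 2) * Real.exp (-(∑ i, x i ^ 2) / 4)

/-- The second variation form `Q(σ,V,B)` of a `(0,1)`-soliton. -/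
def Q (Γ : Conn n m) (σ : ℝ) (V : Fin n → ℝ) (B : Conn n m) : ℝ :=
  -4 * σ ^ 2 * (∫ x : Fin n → ℝ, (∑ k, frobSq (dstarF Γ k x)) * gaussG n x)
    - 2 * (∫ x : Fin n → ℝ,
        (∑ k, frobSq (∑ i, V i • curv Γ i k x)) * gaussG n x)
    + 4 * (∫ x : Fin n → ℝ,
        (∑ k, frobInner (B x k) (Lop Γ B 0 1 k x)) * gaussG n x)
    - 4 * (∫ x : Fin n → ℝ,
        (∑ k, frobInner (B x k)
          (∑ i, (σ * x i + V i) • curv Γ i k x)) * gaussG n x)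

/-- Skew-symmetric-matrix-valued 1-form. -/
def SkewVals (B : Conn n m) : Prop := ∀ x i, (B x i)ᵀ = -(B x i)

/-- `ℱ`-instability. -/
def FUnstable (Γ : Conn n m) : Prop :=
  ∃ B : Conn n m, Smooth B ∧ HasCompactSupport B ∧ SkewVals B ∧
    ∀ (σ : ℝ) (V : Fin n → ℝ), Q Γ σ V B < 0

/-- Joint smoothness (entrywise) of a one-parameter family of connections on a
time set `S`. -/
def SmoothFamilyOn (Γt : ℝ → Conn n m) (S : Set ℝ) : Prop :=
  ∀ (k : Fin n) (a b : Fin m),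
    ContDiffOn ℝ (⊤ : ℕ∞) (fun p : ℝ × (Fin n → ℝ) => Γt p.1 p.2 k a b)
      (S ×ˢ (Set.univ : Set (Fin n → ℝ)))

/-- Yang–Mills flow: `∂ₜ(Γ_t)ₖ = Σᵢ ∇ᵢ(F_t)_{ik}` on a time set `S`. -/
def YMFlowOn (Γt : ℝ → Conn n m) (S : Set ℝ) : Prop :=
  ∀ t ∈ S, ∀ (x : Fin n → ℝ) (k : Fin n) (a b : Fin m),
    HasDerivWithinAt (fun t' => Γt t' x k a b)
      ((∑ i, covDer (Γt t) i (fun y => curv (Γt t) i k y) x) a b) S t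

/-- Locally uniform in time polynomial curvature growth to order two. -/
def PolyCurvGrowth2On (Γt : ℝ → Conn n m) (S : Set ℝ) : Prop :=
  ∀ J : Set ℝ, IsCompact J → J ⊆ S →
    ∃ p : Polynomial ℝ, ∀ t ∈ J, ∀ x,
      normF (Γt t) x
        + (∑ i, ∑ j, ∑ k,
            frobNorm (covDer (Γt t) i (fun y => curv (Γt t) j k y) x))
        + (∑ i, ∑ j, ∑ k, ∑ l,
            frobNorm (covDer (Γt t) i
              (fun y => covDer (Γt t) j (fun z => curv (Γt t) k l z) y) x))
        ≤ p.eval (enorm x)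

end YM

namespace YM

section calculus

variable {n m : ℕ}

/-- Scalar partial derivative. -/
def pd (i : Fin n) (f : (Fin n → ℝ) → ℝ) (x : Fin n → ℝ) : ℝ :=
  fderiv ℝ f x (Pi.single i 1)

/-- Scalar smoothness. -/
def Sm (f : (Fin n → ℝ) → ℝ) : Prop := ContDiff ℝ (⊤ : ℕ∞) f

lemma Sm.diff {f : (Fin n → ℝ) → ℝ} (hf : Sm f) (x : Fin n → ℝ) : DifferentiableAt ℝ f x :=
  (ContDiff.differentiable hf (by simp)) x

lemma Sm.cont {f : (Fin n → ℝ) → ℝ} (hf : Sm f) : Continuous f := ContDiff.continuous hf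

lemma Sm.add {f g : (Fin n → ℝ) → ℝ} (hf : Sm f) (hg : Sm g) : Sm fun x => f x + g x :=
  ContDiff.add hf hg

lemma Sm.sub {f g : (Fin n → ℝ) → ℝ} (hf : Sm f) (hg : Sm g) : Sm fun x => f x - g x :=
  ContDiff.sub hf hg

lemma Sm.mul {f g : (Fin n → ℝ) → ℝ} (hf : Sm f) (hg : Sm g) : Sm fun x => f x * g x :=
  ContDiff.mul hf hg

lemma Sm.sum {ι : Type*} [Fintype ι] {f : ι → (Fin n → ℝ) → ℝ} (hf : ∀ i, Sm (f i)) :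
    Sm fun x => ∑ i, f i x :=
  ContDiff.sum fun i _ => hf i

lemma Sm.const (c : ℝ) : Sm fun _ : Fin n → ℝ => c := contDiff_const

lemma Sm.coord (i : Fin n) (c : ℝ) : Sm fun x : Fin n → ℝ => x i - c :=
  (contDiff_apply ℝ ℝ i).sub contDiff_const

lemma Sm.pd {f : (Fin n → ℝ) → ℝ} (hf : Sm f) (i : Fin n) : Sm (pd i f) := by
  have h : ContDiff ℝ (⊤ : ℕ∞) (fderiv ℝ f) := ContDiff.fderiv_right hf (by simp)
  exact h.clm_apply contDiff_const

lemma pd_add {f g : (Fin n → ℝ) → ℝ} (hf : Sm f) (hg : Sm g) (i : Fin n) (x : Fin n → ℝ) :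
    pd i (fun x => f x + g x) x = pd i f x + pd i g x := by
  simp only [pd]
  rw [fderiv_fun_add (hf.diff x) (hg.diff x)]; rfl

lemma pd_sub {f g : (Fin n → ℝ) → ℝ} (hf : Sm f) (hg : Sm g) (i : Fin n) (x : Fin n → ℝ) :
    pd i (fun x => f x - g x) x = pd i f x - pd i g x := by
  simp only [pd]
  rw [fderiv_fun_sub (hf.diff x) (hg.diff x)]; rfl

lemma pd_mul {f g : (Fin n → ℝ) → ℝ} (hf : Sm f) (hg : Sm g) (i : Fin n) (x : Fin n → ℝ) :
    pd i (fun x => f x * g x) x = pd i f x * g x + f x * pd i g x := by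
  simp only [pd]
  rw [fderiv_fun_mul (hf.diff x) (hg.diff x)]
  simp; ring

lemma pd_sum {ι : Type*} [Fintype ι] {f : ι → (Fin n → ℝ) → ℝ} (hf : ∀ i, Sm (f i))
    (i : Fin n) (x : Fin n → ℝ) :
    pd i (fun x => ∑ j, f j x) x = ∑ j, pd i (f j) x := by
  simp only [pd]
  rw [fderiv_fun_sum (fun j _ => (hf j).diff x)]
  simp

lemma pd_const (c : ℝ) (i : Fin n) (x : Fin n → ℝ) : pd i (fun _ => c) x = 0 := by
  simp [pd]

lemma pd_const_mul {f : (Fin n → ℝ) → ℝ} (hf : Sm f) (c : ℝ) (i : Fin n) (x : Fin n → ℝ) :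
    pd i (fun x => c * f x) x = c * pd i f x := by
  rw [pd_mul (Sm.const c) hf, pd_const]; ring

lemma pd_coord (i k : Fin n) (c : ℝ) (x : Fin n → ℝ) :
    pd i (fun x => x k - c) x = if i = k then 1 else 0 := by
  have : HasFDerivAt (fun x : Fin n → ℝ => x k - c)
      (ContinuousLinearMap.proj (R := ℝ) (φ := fun _ : Fin n => ℝ) k) x :=
    (ContinuousLinearMap.hasFDerivAt
      (ContinuousLinearMap.proj (R := ℝ) (φ := fun _ : Fin n => ℝ) k)).sub_const c
  simp only [pd]
  rw [this.fderiv]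
  simp [Pi.single_apply, eq_comm]

lemma pd_comm {f : (Fin n → ℝ) → ℝ} (hf : Sm f) (i j : Fin n) (x : Fin n → ℝ) :
    pd i (pd j f) x = pd j (pd i f) x := by
  have h : ContDiff ℝ (⊤ : ℕ∞) (fderiv ℝ f) := ContDiff.fderiv_right hf (by simp)
  have hd : DifferentiableAt ℝ (fderiv ℝ f) x := (h.differentiable (by simp)) x
  have key : ∀ i j : Fin n, pd i (pd j f) x
      = fderiv ℝ (fderiv ℝ f) x (Pi.single i 1) (Pi.single j 1) := by
    intro i j
    have h1 : HasFDerivAt (pd j f)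
        ((ContinuousLinearMap.apply ℝ ℝ (Pi.single j (1:ℝ))).comp (fderiv ℝ (fderiv ℝ f) x)) x :=
      (ContinuousLinearMap.hasFDerivAt
        (ContinuousLinearMap.apply ℝ ℝ (Pi.single j (1:ℝ) : Fin n → ℝ))).comp x hd.hasFDerivAt
    simp only [pd] at h1 ⊢
    rw [h1.fderiv]; rfl
  rw [key, key]
  exact (ContDiff.contDiffAt hf).isSymmSndFDerivAt
    (by simp only [minSmoothness_of_isRCLikeNormedField]; exact WithTop.coe_le_coe.2 (le_top (a := (2:ℕ∞)))) _ _

/-! Matrix valued maps. -/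

variable {A B : (Fin n → ℝ) → Matrix (Fin m) (Fin m) ℝ}

lemma pder_apply (i : Fin n) (A : (Fin n → ℝ) → Matrix (Fin m) (Fin m) ℝ) (x a b) :
    pder i A x a b = pd i (fun y => A y a b) x := rfl

lemma SmoothMat.sm (h : SmoothMat A) (a b) : Sm fun y => A y a b := h a b

lemma SmoothMat.add (hA : SmoothMat A) (hB : SmoothMat B) : SmoothMat fun x => A x + B x :=
  fun a b => Sm.add (hA a b) (hB a b)

lemma SmoothMat.sub (hA : SmoothMat A) (hB : SmoothMat B) : SmoothMat fun x => A x - B x :=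
  fun a b => Sm.sub (hA a b) (hB a b)

lemma SmoothMat.mul (hA : SmoothMat A) (hB : SmoothMat B) : SmoothMat fun x => A x * B x := by
  intro a b
  simp only [Matrix.mul_apply]
  exact Sm.sum fun c => Sm.mul (hA a c) (hB c b)

lemma SmoothMat.sum {ι : Type*} [Fintype ι] {A : ι → (Fin n → ℝ) → Matrix (Fin m) (Fin m) ℝ}
    (hA : ∀ i, SmoothMat (A i)) : SmoothMat fun x => ∑ i, A i x := by
  intro a b
  simp only [Matrix.sum_apply]
  exact Sm.sum fun c => hA c a b

lemma SmoothMat.comm (hA : SmoothMat A) (hB : SmoothMat B) :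
    SmoothMat fun x => comm (A x) (B x) := (hA.mul hB).sub (hB.mul hA)

lemma SmoothMat.pder (hA : SmoothMat A) (i : Fin n) : SmoothMat (pder i A) :=
  fun a b => Sm.pd (hA a b) i

lemma SmoothMat.covDer {Γ : Conn n m} (hΓ : Smooth Γ) (hA : SmoothMat A) (i : Fin n) :
    SmoothMat (covDer Γ i A) := (hA.pder i).add ((hΓ i).comm hA)

lemma smooth_curv {Γ : Conn n m} (hΓ : Smooth Γ) (i j : Fin n) :
    SmoothMat (fun x => curv Γ i j x) :=
  (((hΓ j).pder i).sub ((hΓ i).pder j)).add ((hΓ i).comm (hΓ j))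

lemma pder_add (hA : SmoothMat A) (hB : SmoothMat B) (i : Fin n) (x) :
    pder i (fun x => A x + B x) x = pder i A x + pder i B x := by
  ext a b; exact pd_add (hA a b) (hB a b) i x

lemma pder_sub (hA : SmoothMat A) (hB : SmoothMat B) (i : Fin n) (x) :
    pder i (fun x => A x - B x) x = pder i A x - pder i B x := by
  ext a b; exact pd_sub (hA a b) (hB a b) i x

lemma pder_mul (hA : SmoothMat A) (hB : SmoothMat B) (i : Fin n) (x) :
    pder i (fun x => A x * B x) x = pder i A x * B x + A x * pder i B x := by
  ext a b
  simp only [pder_apply, Matrix.mul_apply, Matrix.add_apply]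
  rw [pd_sum (fun c => Sm.mul (hA a c) (hB c b)), ← Finset.sum_add_distrib]
  exact Finset.sum_congr rfl fun c _ => pd_mul (hA a c) (hB c b) i x

lemma pder_comm_mat (hA : SmoothMat A) (hB : SmoothMat B) (i : Fin n) (x) :
    pder i (fun x => comm (A x) (B x)) x = comm (pder i A x) (B x) + comm (A x) (pder i B x) := by
  simp only [comm]
  rw [pder_sub (hA.mul hB) (hB.mul hA), pder_mul hA hB, pder_mul hB hA]
  abel

lemma pder_pder_comm (hA : SmoothMat A) (i j : Fin n) (x) :
    pder i (pder j A) x = pder j (pder i A) x := by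
  ext a b; exact pd_comm (hA a b) i j x

lemma pder_curv {Γ : Conn n m} (hΓ : Smooth Γ) (i j k : Fin n) (x) :
    pder i (fun y => curv Γ j k y) x = pder i (pder j fun y => Γ y k) x
      - pder i (pder k fun y => Γ y j) x
      + (comm (pder i (fun y => Γ y j) x) (Γ x k) + comm (Γ x j) (pder i (fun y => Γ y k) x)) := by
  simp only [curv]
  rw [pder_add (((hΓ k).pder j).sub ((hΓ j).pder k)) ((hΓ j).comm (hΓ k)),
    pder_sub ((hΓ k).pder j) ((hΓ j).pder k), pder_comm_mat (hΓ j) (hΓ k)]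

lemma bianchi {Γ : Conn n m} (hΓ : Smooth Γ) (i j k : Fin n) (x) :
    covDer Γ i (fun y => curv Γ j k y) x + covDer Γ j (fun y => curv Γ k i y) x
      + covDer Γ k (fun y => curv Γ i j y) x = 0 := by
  simp only [covDer]
  rw [pder_curv hΓ, pder_curv hΓ, pder_curv hΓ, pder_pder_comm (hΓ k) i j,
    pder_pder_comm (hΓ j) i k, pder_pder_comm (hΓ i) j k]
  simp only [curv, comm]
  noncomm_ring

lemma curv_antisymm (Γ : Conn n m) (i j : Fin n) (x) : curv Γ i j x = - curv Γ j i x := by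
  simp only [curv, comm]; abel

lemma pder_neg (i : Fin n) (x) : pder i (fun x => - A x) x = - pder i A x := by
  ext a b
  simp [pder]

lemma covDer_neg (Γ : Conn n m) (i : Fin n) (x) :
    covDer Γ i (fun x => - A x) x = - covDer Γ i A x := by
  simp only [covDer, pder_neg, comm]; noncomm_ring

lemma covDer_curv_antisymm (Γ : Conn n m) (i j k : Fin n) (x) :
    covDer Γ i (fun y => curv Γ j k y) x = - covDer Γ i (fun y => curv Γ k j y) x := by
  rw [← covDer_neg]
  congr 1
  funext y
  exact curv_antisymm Γ j k y

/-! Frobenius inner product. -/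

lemma frobInner_eq (A B : Matrix (Fin m) (Fin m) ℝ) : frobInner A B = (A * Bᵀ).trace := by
  simp [frobInner, Matrix.trace, Matrix.mul_apply]

lemma frobInner_comm (A B : Matrix (Fin m) (Fin m) ℝ) : frobInner A B = frobInner B A := by
  simp [frobInner, mul_comm]

lemma frobInner_add_left (A B C : Matrix (Fin m) (Fin m) ℝ) :
    frobInner (A + B) C = frobInner A C + frobInner B C := by
  simp [frobInner_eq, Matrix.add_mul]

lemma frobInner_sub_left (A B C : Matrix (Fin m) (Fin m) ℝ) :
    frobInner (A - B) C = frobInner A C - frobInner B C := by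
  simp [frobInner_eq, Matrix.sub_mul]

lemma frobInner_neg_left (A C : Matrix (Fin m) (Fin m) ℝ) :
    frobInner (-A) C = - frobInner A C := by
  simp [frobInner_eq]

lemma frobInner_neg_right (A C : Matrix (Fin m) (Fin m) ℝ) :
    frobInner A (-C) = - frobInner A C := by
  simp [frobInner_eq]

lemma frobInner_smul_left (c : ℝ) (A C : Matrix (Fin m) (Fin m) ℝ) :
    frobInner (c • A) C = c * frobInner A C := by
  simp [frobInner_eq]

lemma frobInner_sub_right (A B C : Matrix (Fin m) (Fin m) ℝ) :
    frobInner C (A - B) = frobInner C A - frobInner C B := by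
  rw [frobInner_comm, frobInner_sub_left, frobInner_comm A, frobInner_comm B]

lemma frobInner_smul_right (c : ℝ) (A C : Matrix (Fin m) (Fin m) ℝ) :
    frobInner A (c • C) = c * frobInner A C := by
  simp [frobInner_eq]

lemma frobInner_sum_left {ι : Type*} [Fintype ι] (A : ι → Matrix (Fin m) (Fin m) ℝ) (C) :
    frobInner (∑ i, A i) C = ∑ i, frobInner (A i) C := by
  simp [frobInner_eq, Matrix.sum_mul, Matrix.trace_sum]

lemma frobInner_sum_right {ι : Type*} [Fintype ι] (A : ι → Matrix (Fin m) (Fin m) ℝ) (C) :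
    frobInner C (∑ i, A i) = ∑ i, frobInner C (A i) := by
  rw [frobInner_comm, frobInner_sum_left]
  exact Finset.sum_congr rfl fun i _ => frobInner_comm _ _

lemma frobSq_eq (A : Matrix (Fin m) (Fin m) ℝ) : frobSq A = frobInner A A := by
  simp [frobSq, frobInner, sq]

lemma frobSq_nonneg (A : Matrix (Fin m) (Fin m) ℝ) : 0 ≤ frobSq A :=
  Finset.sum_nonneg fun _ _ => Finset.sum_nonneg fun _ _ => sq_nonneg _

lemma frobInner_comm_skew {G : Matrix (Fin m) (Fin m) ℝ} (hG : Gᵀ = -G)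
    (A B : Matrix (Fin m) (Fin m) ℝ) :
    frobInner (comm G A) B + frobInner A (comm G B) = 0 := by
  simp only [frobInner_eq, comm, Matrix.transpose_sub, Matrix.transpose_mul, hG]
  have h := Matrix.trace_mul_comm G (A * Bᵀ)
  simp only [Matrix.sub_mul, Matrix.mul_sub, Matrix.trace_sub, Matrix.mul_neg, Matrix.neg_mul,
    Matrix.trace_neg, Matrix.mul_assoc] at *
  linarith

lemma Sm.frobInner (hA : SmoothMat A) (hB : SmoothMat B) :
    Sm fun x => frobInner (A x) (B x) :=
  Sm.sum fun a => Sm.sum fun b => Sm.mul (hA a b) (hB a b)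

lemma pd_frobInner {Γ : Conn n m} (hmc : MetricCompat Γ) (hA : SmoothMat A) (hB : SmoothMat B)
    (i : Fin n) (x) :
    pd i (fun x => frobInner (A x) (B x)) x
      = frobInner (covDer Γ i A x) (B x) + frobInner (A x) (covDer Γ i B x) := by
  have h1 : pd i (fun x => frobInner (A x) (B x)) x
      = frobInner (pder i A x) (B x) + frobInner (A x) (pder i B x) := by
    simp only [YM.frobInner]
    rw [pd_sum (fun a => Sm.sum fun b => Sm.mul (hA a b) (hB a b)), ← Finset.sum_add_distrib]
    refine Finset.sum_congr rfl fun a _ => ?_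
    rw [pd_sum (fun b => Sm.mul (hA a b) (hB a b)), ← Finset.sum_add_distrib]
    refine Finset.sum_congr rfl fun b _ => ?_
    exact pd_mul (hA a b) (hB a b) i x
  have h2 := frobInner_comm_skew (hmc x i) (A x) (B x)
  have h3 : ∀ P Q R : Matrix (Fin m) (Fin m) ℝ,
      YM.frobInner P (Q + R) = YM.frobInner P Q + YM.frobInner P R := by
    intro P Q R
    rw [frobInner_comm, frobInner_add_left, frobInner_comm Q, frobInner_comm R]
  rw [h1]
  simp only [covDer, frobInner_add_left, h3]
  linarith

end calculus

end YM

namespace YM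

section pointwise

variable {n m : ℕ}

/-- The Yang–Mills velocity `Jₖ = Σᵢ ∇ᵢF_{ik}`. -/
def Jv (Γ : Conn n m) (k : Fin n) (x : Fin n → ℝ) : Matrix (Fin m) (Fin m) ℝ :=
  ∑ i, covDer Γ i (fun y => curv Γ i k y) x

/-- The flux vector field in the monotonicity formula. -/
def Wv (Γ : Conn n m) (x₀ : Fin n → ℝ) (s : ℝ) (i : Fin n) (x : Fin n → ℝ) : ℝ :=
  4 * (∑ j, frobInner (curv Γ i j x) (Jv Γ j x))
    - 4 * s * (∑ k, (x k - x₀ k) * ∑ j, frobInner (curv Γ k j x) (curv Γ i j x))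
    + s * ((x i - x₀ i) * ∑ k, ∑ j, frobInner (curv Γ k j x) (curv Γ k j x))

/-- The divergence terms of the flux field. -/
def dWv (Γ : Conn n m) (x₀ : Fin n → ℝ) (s : ℝ) (i : Fin n) (x : Fin n → ℝ) : ℝ :=
  4 * (∑ j, (frobInner (covDer Γ i (fun y => curv Γ i j y) x) (Jv Γ j x)
      + frobInner (curv Γ i j x) (covDer Γ i (fun y => Jv Γ j y) x)))
    - 4 * s * (∑ k, ((if i = k then 1 else 0) *
          (∑ j, frobInner (curv Γ k j x) (curv Γ i j x))
        + (x k - x₀ k) * ∑ j, (frobInner (covDer Γ i (fun y => curv Γ k j y) x) (curv Γ i j x)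
          + frobInner (curv Γ k j x) (covDer Γ i (fun y => curv Γ i j y) x))))
    + s * (1 * (∑ k, ∑ j, frobInner (curv Γ k j x) (curv Γ k j x))
        + (x i - x₀ i) * ∑ k, ∑ j,
          (frobInner (covDer Γ i (fun y => curv Γ k j y) x) (curv Γ k j x)
          + frobInner (curv Γ k j x) (covDer Γ i (fun y => curv Γ k j y) x)))

lemma smooth_Jv {Γ : Conn n m} (hΓ : Smooth Γ) (k : Fin n) : SmoothMat (fun x => Jv Γ k x) :=
  SmoothMat.sum fun i => SmoothMat.covDer hΓ (smooth_curv hΓ i k) i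

lemma sm_Wv {Γ : Conn n m} (hΓ : Smooth Γ) (x₀ : Fin n → ℝ) (s : ℝ) (i : Fin n) :
    Sm (Wv Γ x₀ s i) := by
  have hF := smooth_curv hΓ
  have hJ := smooth_Jv hΓ
  exact (((Sm.const 4).mul (Sm.sum fun j => Sm.frobInner (hF i j) (hJ j))).sub
    ((Sm.const (4 * s)).mul (Sm.sum fun k => (Sm.coord k (x₀ k)).mul
      (Sm.sum fun j => Sm.frobInner (hF k j) (hF i j))))).add
    ((Sm.const s).mul ((Sm.coord i (x₀ i)).mul
      (Sm.sum fun k => Sm.sum fun j => Sm.frobInner (hF k j) (hF k j))))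

lemma pd_Wv {Γ : Conn n m} (hΓ : Smooth Γ) (hmc : MetricCompat Γ) (x₀ : Fin n → ℝ) (s : ℝ)
    (i : Fin n) (x : Fin n → ℝ) : pd i (Wv Γ x₀ s i) x = dWv Γ x₀ s i x := by
  have hF := smooth_curv hΓ
  have hJ := smooth_Jv hΓ
  have s1 : Sm fun x => ∑ j, frobInner (curv Γ i j x) (Jv Γ j x) :=
    Sm.sum fun j => Sm.frobInner (hF i j) (hJ j)
  have s2 : ∀ k, Sm fun x => ∑ j, frobInner (curv Γ k j x) (curv Γ i j x) := fun k =>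
    Sm.sum fun j => Sm.frobInner (hF k j) (hF i j)
  have s2' : ∀ k, Sm fun x => (x k - x₀ k) * ∑ j, frobInner (curv Γ k j x) (curv Γ i j x) :=
    fun k => (Sm.coord k (x₀ k)).mul (s2 k)
  have s3' : ∀ k, Sm fun x => ∑ j, frobInner (curv Γ k j x) (curv Γ k j x) :=
    fun k => Sm.sum fun j => Sm.frobInner (hF k j) (hF k j)
  have s3 : Sm fun x => ∑ k, ∑ j, frobInner (curv Γ k j x) (curv Γ k j x) :=
    Sm.sum s3'
  unfold Wv dWv
  rw [pd_add (((Sm.const 4).mul s1).sub ((Sm.const (4 * s)).mul (Sm.sum s2')))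
      ((Sm.const s).mul ((Sm.coord i (x₀ i)).mul s3)),
    pd_sub ((Sm.const 4).mul s1) ((Sm.const (4 * s)).mul (Sm.sum s2')),
    pd_const_mul s1, pd_const_mul (Sm.sum s2'), pd_const_mul ((Sm.coord i (x₀ i)).mul s3),
    pd_mul (Sm.coord i (x₀ i)) s3, pd_sum s2', pd_sum s3',
    pd_sum (fun j => Sm.frobInner (hF i j) (hJ j)), pd_coord, if_pos rfl]
  congr 1
  · congr 1
    · congr 1
      exact Finset.sum_congr rfl fun j _ => pd_frobInner hmc (hF i j) (hJ j) i x
    · congr 1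
      refine Finset.sum_congr rfl fun k _ => ?_
      rw [pd_mul (Sm.coord k (x₀ k)) (s2 k), pd_coord,
        pd_sum fun j => Sm.frobInner (hF k j) (hF i j)]
      congr 2
      exact Finset.sum_congr rfl fun j _ => pd_frobInner hmc (hF k j) (hF i j) i x
  · congr 3
    refine Finset.sum_congr rfl fun k _ => ?_
    rw [pd_sum fun j => Sm.frobInner (hF k j) (hF k j)]
    exact Finset.sum_congr rfl fun j _ => pd_frobInner hmc (hF k j) (hF k j) i x

/-- The time derivative integrand (divided by the Gaussian). -/
def Ev (Γ : Conn n m) (x₀ : Fin n → ℝ) (s : ℝ) (x : Fin n → ℝ) : ℝ :=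
  4 * (∑ i, ∑ j, frobInner (curv Γ i j x) (covDer Γ i (fun y => Jv Γ j y) x))
    - s ^ 2 * (∑ i, (x i - x₀ i) ^ 2) * normSqF Γ x

lemma key_pointwise {Γ : Conn n m} (hΓ : Smooth Γ) (x₀ : Fin n → ℝ) (s : ℝ) (x : Fin n → ℝ) :
    Ev Γ x₀ s x - (4 - n) * s * normSqF Γ x
      ≤ ∑ i, (dWv Γ x₀ s i x - s * (x i - x₀ i) * Wv Γ x₀ s i x) := by
  have hN : normSqF Γ x = ∑ k, ∑ j, frobInner (curv Γ k j x) (curv Γ k j x) := by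
    simp only [normSqF, frobSq_eq]
  unfold Ev dWv Wv
  rw [hN]
  set F : Fin n → Fin n → Matrix (Fin m) (Fin m) ℝ := fun i j => curv Γ i j x with hFdef
  set D : Fin n → Fin n → Fin n → Matrix (Fin m) (Fin m) ℝ :=
    fun i j k => covDer Γ i (fun y => curv Γ j k y) x with hD
  set E : Fin n → Fin n → Matrix (Fin m) (Fin m) ℝ :=
    fun i j => covDer Γ i (fun y => Jv Γ j y) x with hE
  set y : Fin n → ℝ := fun i => x i - x₀ i with hy
  set J : Fin n → Matrix (Fin m) (Fin m) ℝ := fun k => Jv Γ k x with hJdef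
  have eF : ∀ i j, curv Γ i j x = F i j := fun _ _ => rfl
  have eD : ∀ i j k, covDer Γ i (fun y => curv Γ j k y) x = D i j k := fun _ _ _ => rfl
  have eE : ∀ i j, covDer Γ i (fun y => Jv Γ j y) x = E i j := fun _ _ => rfl
  have ey : ∀ i, x i - x₀ i = y i := fun _ => rfl
  have eJ : ∀ i, Jv Γ i x = J i := fun _ => rfl
  have hJ : ∀ k, J k = ∑ i, D i i k := fun _ => rfl
  have hFa : ∀ i j, F i j = - F j i := fun i j => curv_antisymm Γ i j x
  have hDa : ∀ i j k, D i j k = - D i k j := fun i j k => covDer_curv_antisymm Γ i j k x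
  have hB : ∀ i j k, D i j k + D j k i + D k i j = 0 := fun i j k => bianchi hΓ i j k x
  simp only [eF, eD, eE, ey, eJ]
  clear_value F D E y J
  set X : Fin n → Matrix (Fin m) (Fin m) ℝ := fun j => ∑ k, y k • F k j with hX
  set N := ∑ k, ∑ j, frobInner (F k j) (F k j) with hNdef
  -- identity 1
  have i1 : ∑ i, ∑ j, frobInner (D i i j) (J j) = ∑ j, frobInner (J j) (J j) := by
    rw [Finset.sum_comm]
    refine Finset.sum_congr rfl fun j _ => ?_
    conv_rhs => rw [hJ j]
    rw [frobInner_sum_left, ← hJ j]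
  have i2 : ∑ i, ∑ k, (if i = k then (1:ℝ) else 0) * (∑ j, frobInner (F k j) (F i j)) = N := by
    simp [hNdef]
  have i5g : ∀ Z : Fin n → Matrix (Fin m) (Fin m) ℝ,
      ∑ i, y i * ∑ j, frobInner (F i j) (Z j) = ∑ j, frobInner (X j) (Z j) := by
    intro Z
    simp only [hX, frobInner_sum_left, frobInner_smul_left, Finset.mul_sum]
    rw [Finset.sum_comm]
  have i5 := i5g J
  have i4 : ∑ i, ∑ k, y k * ∑ j, frobInner (F k j) (D i i j)
      = ∑ j, frobInner (X j) (J j) := by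
    rw [← i5, Finset.sum_comm]
    refine Finset.sum_congr rfl fun k _ => ?_
    simp only [hJ, frobInner_sum_right]
    rw [← Finset.mul_sum, Finset.sum_comm]
  have i6 : ∑ i, y i * ∑ k, y k * ∑ j, frobInner (F k j) (F i j)
      = ∑ j, frobInner (X j) (X j) := by
    rw [← i5g X]
    refine Finset.sum_congr rfl fun i _ => ?_
    rw [i5g (F i)]
    congr 1
    exact Finset.sum_congr rfl fun j _ => frobInner_comm _ _
  have i7 : 0 ≤ (∑ j, frobInner (J j) (J j)) - 2 * s * (∑ j, frobInner (X j) (J j))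
      + s ^ 2 * (∑ j, frobInner (X j) (X j)) := by
    have : 0 ≤ ∑ j, frobSq (J j - s • X j) := Finset.sum_nonneg fun j _ => frobSq_nonneg _
    refine this.trans_eq ?_
    simp only [Finset.mul_sum]
    rw [← Finset.sum_sub_distrib, ← Finset.sum_add_distrib]
    refine Finset.sum_congr rfl fun j _ => ?_
    rw [frobSq_eq, frobInner_sub_left, frobInner_sub_right, frobInner_sub_right,
      frobInner_smul_left, frobInner_smul_left, frobInner_smul_right, frobInner_smul_right,
      frobInner_comm (J j) (X j)]
    ring
  have i8 : ∀ k, ∑ i, ∑ j, frobInner (D k i j) (F i j)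
      = 2 * ∑ i, ∑ j, frobInner (D i k j) (F i j) := by
    intro k
    have a1 : ∑ i, ∑ j, frobInner (D j i k) (F i j) = ∑ i, ∑ j, frobInner (D i k j) (F i j) := by
      rw [Finset.sum_comm]
      refine Finset.sum_congr rfl fun i _ => Finset.sum_congr rfl fun j _ => ?_
      rw [hDa i j k, hFa j i, frobInner_neg_left, frobInner_neg_right, neg_neg]
    have a2 : ∀ i j, frobInner (D k i j) (F i j) = frobInner (D i k j) (F i j)
        + frobInner (D j i k) (F i j) := by
      intro i j
      have h0 := hB k i j
      have h1 : D k i j = D i k j + D j i k := by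
        rw [hDa i k j, hDa j i k]
        rw [add_assoc] at h0
        rw [eq_neg_of_add_eq_zero_left h0]; abel
      rw [h1, frobInner_add_left]
    simp only [a2, Finset.sum_add_distrib]
    rw [a1]; ring
  have i3 : ∑ i, y i * ∑ k, ∑ j, frobInner (D i k j) (F k j)
      = 2 * ∑ i, ∑ k, y k * ∑ j, frobInner (D i k j) (F i j) := by
    simp only [i8]
    rw [Finset.sum_comm (γ := Fin n)]
    simp only [Finset.mul_sum]
    refine Finset.sum_congr rfl fun i _ => Finset.sum_congr rfl fun k _ =>
      Finset.sum_congr rfl fun j _ => ?_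
    ring
  have i3' : ∑ i, y i * ∑ k, ∑ j, frobInner (F k j) (D i k j)
      = 2 * ∑ i, ∑ k, y k * ∑ j, frobInner (D i k j) (F i j) := by
    rw [← i3]
    simp only [frobInner_comm]
  clear_value N
  have i9 : ∑ i, s * y i * (s * (y i * N)) = s ^ 2 * (∑ i, y i ^ 2) * N := by
    rw [Finset.mul_sum, Finset.sum_mul]
    exact Finset.sum_congr rfl fun i _ => by ring
  have i5' : ∑ i, s * y i * (4 * ∑ j, frobInner (F i j) (J j))
      = 4 * s * ∑ j, frobInner (X j) (J j) := by
    rw [← i5, Finset.mul_sum]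
    exact Finset.sum_congr rfl fun i _ => by ring
  have i6' : ∑ i, s * y i * (4 * s * ∑ k, y k * ∑ j, frobInner (F k j) (F i j))
      = 4 * s ^ 2 * ∑ j, frobInner (X j) (X j) := by
    rw [← i6, Finset.mul_sum]
    exact Finset.sum_congr rfl fun i _ => by ring
  simp only [Finset.sum_sub_distrib, Finset.sum_add_distrib, mul_add, mul_sub, ← Finset.mul_sum,
    i1, i2, i3, i3', i4, i5', i6', i9]
  simp only [← mul_assoc, Finset.sum_const, Finset.card_univ, Fintype.card_fin, nsmul_eq_mul] at *
  nlinarith [i7]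

end pointwise

end YM

namespace YM

section growth

variable {n m : ℕ}

/-- Polynomial growth in space, uniformly for times in `J`. -/
def PG (J : Set ℝ) (f : ℝ → (Fin n → ℝ) → ℝ) : Prop :=
  ∃ C : ℝ, 0 ≤ C ∧ ∃ N : ℕ, ∀ t ∈ J, ∀ x, |f t x| ≤ C * (1 + ‖x‖) ^ N

variable {J : Set ℝ} {f g : ℝ → (Fin n → ℝ) → ℝ}

lemma PG.mono' (hg : PG J g) (h : ∀ t ∈ J, ∀ x, |f t x| ≤ |g t x|) : PG J f := by
  obtain ⟨C, hC, N, hN⟩ := hg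
  exact ⟨C, hC, N, fun t ht x => (h t ht x).trans (hN t ht x)⟩

lemma PG.subset {K : Set ℝ} (hf : PG J f) (h : K ⊆ J) : PG K f := by
  obtain ⟨C, hC, N, hN⟩ := hf
  exact ⟨C, hC, N, fun t ht x => hN t (h ht) x⟩

lemma PG.add (hf : PG J f) (hg : PG J g) : PG J fun t x => f t x + g t x := by
  obtain ⟨C, hC, N, hN⟩ := hf
  obtain ⟨C', hC', N', hN'⟩ := hg
  refine ⟨C + C', by positivity, N + N', fun t ht x => ?_⟩
  have h1 : (1:ℝ) ≤ 1 + ‖x‖ := by linarith [norm_nonneg x]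
  have h2 : (1 + ‖x‖) ^ N ≤ (1 + ‖x‖) ^ (N + N') := pow_le_pow_right₀ h1 (by omega)
  have h3 : (1 + ‖x‖) ^ N' ≤ (1 + ‖x‖) ^ (N + N') := pow_le_pow_right₀ h1 (by omega)
  calc |f t x + g t x| ≤ |f t x| + |g t x| := abs_add_le _ _
    _ ≤ C * (1 + ‖x‖) ^ N + C' * (1 + ‖x‖) ^ N' := add_le_add (hN t ht x) (hN' t ht x)
    _ ≤ C * (1 + ‖x‖) ^ (N + N') + C' * (1 + ‖x‖) ^ (N + N') := by gcongr
    _ = _ := by ring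

lemma PG.mul (hf : PG J f) (hg : PG J g) : PG J fun t x => f t x * g t x := by
  obtain ⟨C, hC, N, hN⟩ := hf
  obtain ⟨C', hC', N', hN'⟩ := hg
  refine ⟨C * C', by positivity, N + N', fun t ht x => ?_⟩
  rw [abs_mul]
  calc |f t x| * |g t x| ≤ (C * (1 + ‖x‖) ^ N) * (C' * (1 + ‖x‖) ^ N') :=
        mul_le_mul (hN t ht x) (hN' t ht x) (abs_nonneg _) (by positivity)
    _ = _ := by ring

lemma PG.neg (hf : PG J f) : PG J fun t x => - f t x := by
  obtain ⟨C, hC, N, hN⟩ := hf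
  exact ⟨C, hC, N, fun t ht x => by rw [abs_neg]; exact hN t ht x⟩

lemma PG.sub (hf : PG J f) (hg : PG J g) : PG J fun t x => f t x - g t x := by
  simpa only [sub_eq_add_neg] using hf.add hg.neg

lemma PG.time {c : ℝ → ℝ} (M : ℝ) (h : ∀ t ∈ J, |c t| ≤ M) :
    PG J fun t (_ : Fin n → ℝ) => c t := by
  refine ⟨max M 0, le_max_right _ _, 0, fun t ht x => ?_⟩
  simpa using Or.inl (h t ht)

lemma PG.const (c : ℝ) : PG J fun _ (_ : Fin n → ℝ) => c := PG.time |c| fun _ _ => le_rfl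

lemma PG.sum {ι : Type*} [Fintype ι] {f : ι → ℝ → (Fin n → ℝ) → ℝ} (hf : ∀ i, PG J (f i)) :
    PG J fun t x => ∑ i, f i t x := by
  classical
  have : ∀ S : Finset ι, PG J fun t x => ∑ i ∈ S, f i t x := by
    intro S
    induction S using Finset.induction_on with
    | empty => simpa using PG.const 0
    | insert a S ha ih =>
      simp only [Finset.sum_insert ha]
      exact (hf a).add ih
  exact this _

lemma PG.coord (i : Fin n) (c : ℝ) : PG J fun _ x => x i - c := by
  refine PG.sub ⟨1, zero_le_one, 1, fun t _ x => ?_⟩ (PG.const c)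
  have : ‖x i‖ ≤ ‖x‖ := norm_le_pi_norm x i
  rw [Real.norm_eq_abs] at this
  linarith

lemma PG.enorm : PG J fun _ (x : Fin n → ℝ) => YM.enorm x := by
  have h : PG J fun _ (x : Fin n → ℝ) => 1 + ∑ i, (x i - 0) * (x i - 0) :=
    (PG.const 1).add (PG.sum fun i => (PG.coord i 0).mul (PG.coord i 0))
  refine h.mono' fun t _ x => ?_
  have h0 : 0 ≤ ∑ i, x i ^ 2 := Finset.sum_nonneg fun i _ => sq_nonneg _
  have e : ∑ i, (x i - 0) * (x i - 0) = ∑ i, x i ^ 2 := by simp [sq]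
  rw [e]
  have h1 : YM.enorm x = Real.sqrt (∑ i, x i ^ 2) := rfl
  rw [h1, abs_of_nonneg (Real.sqrt_nonneg _), abs_of_nonneg (by linarith)]
  exact (Real.sqrt_le_left (by linarith)).2 (by nlinarith)

lemma PG.poly (p : Polynomial ℝ) : PG J fun _ (x : Fin n → ℝ) => p.eval (YM.enorm x) := by
  induction p using Polynomial.induction_on' with
  | add p q hp hq => simpa only [Polynomial.eval_add] using hp.add hq
  | monomial k a =>
    simp only [Polynomial.eval_monomial]
    refine (PG.const a).mul ?_
    induction k with
    | zero => simpa using PG.const 1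
    | succ k ih => simpa only [pow_succ] using ih.mul PG.enorm

/-- Gaussian weight. -/
def gw (x₀ : Fin n → ℝ) (s : ℝ) (x : Fin n → ℝ) : ℝ :=
  Real.exp (-(s / 2 * ∑ i, (x i - x₀ i) ^ 2))

lemma sm_gw (x₀ : Fin n → ℝ) (s : ℝ) : Sm (gw x₀ s) := by
  have : Sm fun x : Fin n → ℝ => 0 - s / 2 * ∑ i, (x i - x₀ i) * (x i - x₀ i) :=
    (Sm.const 0).sub ((Sm.const (s / 2)).mul (Sm.sum fun i => (Sm.coord i _).mul (Sm.coord i _)))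
  have h2 := ContDiff.exp this
  simp only [zero_sub, ← sq] at h2
  exact h2

lemma gw_pos (x₀ : Fin n → ℝ) (s : ℝ) (x) : 0 < gw x₀ s x := Real.exp_pos _

lemma pd_gw (x₀ : Fin n → ℝ) (s : ℝ) (i : Fin n) (x) :
    pd i (gw x₀ s) x = - (s * (x i - x₀ i)) * gw x₀ s x := by
  have hs : Sm fun x : Fin n → ℝ => ∑ i, (x i - x₀ i) * (x i - x₀ i) :=
    Sm.sum fun i => (Sm.coord i _).mul (Sm.coord i _)
  have e : gw x₀ s = fun x => Real.exp ((-(s/2)) * ∑ i, (x i - x₀ i) * (x i - x₀ i)) := by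
    funext x; simp only [gw, sq, neg_mul]
  have h1 := pd_const_mul hs (-(s/2)) i x
  rw [pd_sum (fun i => (Sm.coord i _).mul (Sm.coord i _))] at h1
  have h2 : ∀ j, pd i (fun x => (x j - x₀ j) * (x j - x₀ j)) x
      = if i = j then 2 * (x i - x₀ i) else 0 := by
    intro j
    rw [pd_mul (Sm.coord j _) (Sm.coord j _), pd_coord]
    split_ifs with h
    · subst h; ring
    · ring
  simp only [h2, Finset.sum_ite_eq, Finset.mem_univ, if_true] at h1
  rw [e]
  unfold pd at h1 ⊢
  rw [fderiv_exp (((Sm.const _).mul hs).diff x)]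
  simp only [FunLike.coe_smul, Pi.smul_apply, smul_eq_mul]
  rw [h1]; ring

lemma gw_mono (x₀ : Fin n → ℝ) {s s' : ℝ} (h : s' ≤ s) (x) : gw x₀ s x ≤ gw x₀ s' x := by
  apply Real.exp_le_exp.2
  have : 0 ≤ ∑ i, (x i - x₀ i) ^ 2 := Finset.sum_nonneg fun i _ => sq_nonneg _
  nlinarith

lemma integrable_gw (x₀ : Fin n → ℝ) {s : ℝ} (hs : 0 < s) : Integrable (gw x₀ s) := by
  have h : Integrable (fun x : Fin n → ℝ => ∏ i, Real.exp (-(s/2) * (x i - x₀ i) ^ 2)) := by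
    refine Integrable.fintype_prod_dep (f := fun i (v : ℝ) => Real.exp (-(s/2) * (v - x₀ i) ^ 2))
      fun i => ?_
    exact (integrable_exp_neg_mul_sq (by positivity : 0 < s / 2)).comp_sub_right (x₀ i)
  refine h.congr (Eventually.of_forall fun x => ?_)
  simp only [gw]
  rw [← Real.exp_sum, ← Finset.mul_sum, neg_mul]

lemma poly_gw_le (x₀ : Fin n → ℝ) {s : ℝ} (hs : 0 < s) (N : ℕ) :
    ∃ K : ℝ, ∀ x, (1 + ‖x‖) ^ N * gw x₀ s x ≤ K * gw x₀ (s/2) x := by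
  refine ⟨(1 + ‖x₀‖) ^ N * (N.factorial * Real.exp (1 + 1 / s)), fun x => ?_⟩
  set r := ‖x - x₀‖ with hr
  have hr0 : 0 ≤ r := norm_nonneg _
  have h1 : 1 + ‖x‖ ≤ (1 + ‖x₀‖) * (1 + r) := by
    have : ‖x‖ ≤ ‖x₀‖ + r := by
      calc ‖x‖ = ‖x₀ + (x - x₀)‖ := by congr 1; abel
        _ ≤ _ := norm_add_le _ _
    nlinarith [norm_nonneg x₀]
  have h2 : (1 + r) ^ N ≤ N.factorial * Real.exp (1 + r) := by
    have := Real.pow_div_factorial_le_exp (1 + r) (by linarith) N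
    rw [div_le_iff₀ (by positivity)] at this
    linarith
  have h3 : r ^ 2 ≤ ∑ i, (x i - x₀ i) ^ 2 := by
    have h0 : 0 ≤ ∑ i, (x i - x₀ i) ^ 2 := Finset.sum_nonneg fun i _ => sq_nonneg _
    have : r ≤ Real.sqrt (∑ i, (x i - x₀ i) ^ 2) := by
      rw [hr, pi_norm_le_iff_of_nonneg (Real.sqrt_nonneg _)]
      intro i
      rw [Real.norm_eq_abs, ← Real.sqrt_sq_eq_abs]
      apply Real.sqrt_le_sqrt
      exact Finset.single_le_sum (f := fun i => (x i - x₀ i) ^ 2) (fun i _ => sq_nonneg _)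
        (Finset.mem_univ i)
    calc r ^ 2 ≤ (Real.sqrt (∑ i, (x i - x₀ i) ^ 2)) ^ 2 := by gcongr
      _ = _ := Real.sq_sqrt h0
  have h4 : r ≤ 1 / s + s / 4 * r ^ 2 := by
    have e : 1 / s + s / 4 * r ^ 2 - r = (1 / s) * (1 - s * r / 2) ^ 2 := by
      field_simp; ring
    have : 0 ≤ (1 / s) * (1 - s * r / 2) ^ 2 := by positivity
    linarith
  have h5 : Real.exp (1 + r) * gw x₀ s x ≤ Real.exp (1 + 1 / s) * gw x₀ (s/2) x := by
    simp only [gw, ← Real.exp_add]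
    apply Real.exp_le_exp.2
    nlinarith
  have hg := gw_pos x₀ s x
  calc (1 + ‖x‖) ^ N * gw x₀ s x ≤ ((1 + ‖x₀‖) * (1 + r)) ^ N * gw x₀ s x := by gcongr
    _ = (1 + ‖x₀‖) ^ N * ((1 + r) ^ N * gw x₀ s x) := by rw [mul_pow]; ring
    _ ≤ (1 + ‖x₀‖) ^ N * ((N.factorial * Real.exp (1 + r)) * gw x₀ s x) := by gcongr
    _ = (1 + ‖x₀‖) ^ N * (N.factorial * (Real.exp (1 + r) * gw x₀ s x)) := by ring
    _ ≤ (1 + ‖x₀‖) ^ N * (N.factorial * (Real.exp (1 + 1 / s) * gw x₀ (s/2) x)) := by gcongr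
    _ = _ := by ring

lemma integrable_poly_gw (x₀ : Fin n → ℝ) {s : ℝ} (hs : 0 < s) (C : ℝ) (N : ℕ) :
    Integrable fun x : Fin n → ℝ => C * (1 + ‖x‖) ^ N * gw x₀ s x := by
  obtain ⟨K, hK⟩ := poly_gw_le x₀ hs N
  have : Integrable fun x : Fin n → ℝ => (1 + ‖x‖) ^ N * gw x₀ s x := by
    refine ((integrable_gw x₀ (half_pos hs)).const_mul K).mono' ?_ (Eventually.of_forall ?_)
    · exact (((continuous_const.add continuous_norm).pow N).mul (sm_gw x₀ s).cont).aestronglyMeasurable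
    · intro x
      rw [Real.norm_of_nonneg (mul_nonneg (by positivity) (gw_pos _ _ _).le)]
      exact hK x
  simpa only [mul_assoc] using this.const_mul C

lemma PG.integrable (x₀ : Fin n → ℝ) {s : ℝ} (hs : 0 < s) (hf : PG J f) {t : ℝ} (ht : t ∈ J)
    (hc : Continuous (f t)) : Integrable fun x => f t x * gw x₀ s x := by
  obtain ⟨C, hC, N, hN⟩ := hf
  refine (integrable_poly_gw x₀ hs C N).mono' (hc.mul (sm_gw x₀ s).cont).aestronglyMeasurable
    (Eventually.of_forall fun x => ?_)
  rw [norm_mul, Real.norm_of_nonneg (gw_pos _ _ _).le]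
  exact mul_le_mul_of_nonneg_right (hN t ht x) (gw_pos _ _ _).le

lemma gauss_ibp (x₀ : Fin n → ℝ) {s : ℝ} (hs : 0 < s) {t : ℝ} (ht : t ∈ J) (i : Fin n)
    (hsm : Sm (f t)) (hf : PG J f) (hf' : PG J fun t => pd i (f t)) :
    Integrable (fun x => (pd i (f t) x - s * (x i - x₀ i) * f t x) * gw x₀ s x) ∧
    ∫ x, (pd i (f t) x - s * (x i - x₀ i) * f t x) * gw x₀ s x = 0 := by
  have I1 : Integrable fun x => pd i (f t) x * gw x₀ s x :=
    hf'.integrable x₀ hs ht (hsm.pd i).cont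
  have I2 : Integrable fun x => (s * (x i - x₀ i) * f t x) * gw x₀ s x :=
    PG.integrable (J := J) (f := fun t x => s * (x i - x₀ i) * f t x) x₀ hs
      (((PG.const s).mul (PG.coord i _)).mul hf) ht
      (((Sm.const s).mul (Sm.coord i _)).mul hsm).cont
  have I3 : Integrable fun x => f t x * gw x₀ s x := hf.integrable x₀ hs ht hsm.cont
  have e : ∀ x, f t x * pd i (gw x₀ s) x = - ((s * (x i - x₀ i) * f t x) * gw x₀ s x) := by
    intro x; rw [pd_gw]; ring
  have I2' : Integrable fun x => f t x * pd i (gw x₀ s) x := by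
    simp only [e]; exact I2.neg
  have h := integral_mul_fderiv_eq_neg_fderiv_mul_of_integrable (μ := volume) (𝕜 := ℝ) I1 I2' I3
    (fun x _ => hsm.diff x) (fun x _ => (sm_gw x₀ s).diff x)
  have h' : ∫ x, f t x * pd i (gw x₀ s) x = - ∫ x, pd i (f t) x * gw x₀ s x := h
  simp only [e, integral_neg] at h'
  simp only [sub_mul]
  refine ⟨I1.sub I2, ?_⟩
  rw [integral_sub I1 I2]
  linarith

end growth

end YM

namespace YM

section families

variable {n m : ℕ}

/-- Entrywise polynomial growth. -/
def PGM (J : Set ℝ) (A : ℝ → (Fin n → ℝ) → Matrix (Fin m) (Fin m) ℝ) : Prop :=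
  ∀ a b, PG J fun t x => A t x a b

variable {J : Set ℝ}

lemma PGM.inner {A B : ℝ → (Fin n → ℝ) → Matrix (Fin m) (Fin m) ℝ} (hA : PGM J A)
    (hB : PGM J B) : PG J fun t x => frobInner (A t x) (B t x) :=
  PG.sum fun a => PG.sum fun b => (hA a b).mul (hB a b)

lemma PGM.sum {ι : Type*} [Fintype ι] {A : ι → ℝ → (Fin n → ℝ) → Matrix (Fin m) (Fin m) ℝ}
    (hA : ∀ i, PGM J (A i)) : PGM J fun t x => ∑ i, A i t x := by
  intro a b
  simp only [Matrix.sum_apply]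
  exact PG.sum fun i => hA i a b

lemma PGM.congr {A B : ℝ → (Fin n → ℝ) → Matrix (Fin m) (Fin m) ℝ} (hA : PGM J A)
    (h : ∀ t ∈ J, ∀ x, B t x = A t x) : PGM J B := by
  intro a b
  refine (hA a b).mono' fun t ht x => ?_
  rw [h t ht x]

lemma abs_entry_le (A : Matrix (Fin m) (Fin m) ℝ) (a b) : |A a b| ≤ frobNorm A := by
  rw [frobNorm, ← Real.sqrt_sq_eq_abs]
  apply Real.sqrt_le_sqrt
  calc (A a b) ^ 2 ≤ ∑ b, (A a b) ^ 2 :=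
        Finset.single_le_sum (f := fun b => (A a b) ^ 2) (fun _ _ => sq_nonneg _)
          (Finset.mem_univ b)
    _ ≤ frobSq A :=
        Finset.single_le_sum (f := fun a => ∑ b, (A a b) ^ 2)
          (fun _ _ => Finset.sum_nonneg fun _ _ => sq_nonneg _) (Finset.mem_univ a)

lemma frobNorm_nonneg (A : Matrix (Fin m) (Fin m) ℝ) : 0 ≤ frobNorm A := Real.sqrt_nonneg _

lemma single_le_sum_univ {ι : Type*} [Fintype ι] {f : ι → ℝ} (hf : ∀ i, 0 ≤ f i) (i : ι) :
    f i ≤ ∑ j, f j :=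
  Finset.single_le_sum (fun j _ => hf j) (Finset.mem_univ i)

lemma frobNorm_curv_le (Γ : Conn n m) (i j x) : frobNorm (curv Γ i j x) ≤ normF Γ x := by
  apply Real.sqrt_le_sqrt
  have h : ∀ i, 0 ≤ ∑ j, frobSq (curv Γ i j x) := fun i =>
    Finset.sum_nonneg fun _ _ => frobSq_nonneg _
  exact (single_le_sum_univ (fun j => frobSq_nonneg (curv Γ i j x)) j).trans
    (single_le_sum_univ h i)

section bounds

variable {Γt : ℝ → Conn n m} {S : Set ℝ}

lemma growth_all (hpoly : PolyCurvGrowth2On Γt S) (hJ : IsCompact J) (hJS : J ⊆ S) :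
    (∀ i j, PGM J fun t x => curv (Γt t) i j x) ∧
    (∀ i j k, PGM J fun t x => covDer (Γt t) i (fun y => curv (Γt t) j k y) x) ∧
    (∀ i j k l, PGM J fun t x => covDer (Γt t) i
      (fun y => covDer (Γt t) j (fun z => curv (Γt t) k l z) y) x) := by
  obtain ⟨p, hp⟩ := hpoly J hJ hJS
  have hP : PG J fun _ (x : Fin n → ℝ) => p.eval (enorm x) := PG.poly p
  have n1 : ∀ t x, 0 ≤ ∑ i, ∑ j, ∑ k,
      frobNorm (covDer (Γt t) i (fun y => curv (Γt t) j k y) x) := fun t x =>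
    Finset.sum_nonneg fun _ _ => Finset.sum_nonneg fun _ _ => Finset.sum_nonneg fun _ _ =>
      frobNorm_nonneg _
  have n2 : ∀ t x, 0 ≤ ∑ i, ∑ j, ∑ k, ∑ l, frobNorm (covDer (Γt t) i
      (fun y => covDer (Γt t) j (fun z => curv (Γt t) k l z) y) x) := fun t x =>
    Finset.sum_nonneg fun _ _ => Finset.sum_nonneg fun _ _ => Finset.sum_nonneg fun _ _ =>
      Finset.sum_nonneg fun _ _ => frobNorm_nonneg _
  have n0 : ∀ t x, 0 ≤ normF (Γt t) x := fun t x => Real.sqrt_nonneg _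
  refine ⟨fun i j a b => hP.mono' fun t ht x => ?_, fun i j k a b => hP.mono' fun t ht x => ?_,
    fun i j k l a b => hP.mono' fun t ht x => ?_⟩
  · refine (abs_entry_le _ a b).trans (le_trans ?_ (le_abs_self _))
    have h1 := frobNorm_curv_le (Γt t) i j x
    linarith [hp t ht x, n1 t x, n2 t x]
  · refine (abs_entry_le _ a b).trans (le_trans ?_ (le_abs_self _))
    have h1 : frobNorm (covDer (Γt t) i (fun y => curv (Γt t) j k y) x) ≤ ∑ i, ∑ j, ∑ k,
        frobNorm (covDer (Γt t) i (fun y => curv (Γt t) j k y) x) := by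
      refine le_trans ?_ (single_le_sum_univ (fun i => Finset.sum_nonneg fun _ _ =>
        Finset.sum_nonneg fun _ _ => frobNorm_nonneg _) i)
      refine le_trans ?_ (single_le_sum_univ (fun i =>
        Finset.sum_nonneg fun _ _ => frobNorm_nonneg _) j)
      exact single_le_sum_univ (f := fun k =>
        frobNorm (covDer (Γt t) i (fun y => curv (Γt t) j k y) x)) (fun i => frobNorm_nonneg _) k
    linarith [hp t ht x, n0 t x, n2 t x]
  · refine (abs_entry_le _ a b).trans (le_trans ?_ (le_abs_self _))
    have h1 : frobNorm (covDer (Γt t) i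
        (fun y => covDer (Γt t) j (fun z => curv (Γt t) k l z) y) x) ≤ ∑ i, ∑ j, ∑ k, ∑ l,
        frobNorm (covDer (Γt t) i
          (fun y => covDer (Γt t) j (fun z => curv (Γt t) k l z) y) x) := by
      refine le_trans ?_ (single_le_sum_univ (fun i => Finset.sum_nonneg fun _ _ =>
        Finset.sum_nonneg fun _ _ => Finset.sum_nonneg fun _ _ => frobNorm_nonneg _) i)
      refine le_trans ?_ (single_le_sum_univ (fun i =>
        Finset.sum_nonneg fun _ _ => Finset.sum_nonneg fun _ _ => frobNorm_nonneg _) j)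
      refine le_trans ?_ (single_le_sum_univ (fun i =>
        Finset.sum_nonneg fun _ _ => frobNorm_nonneg _) k)
      exact single_le_sum_univ (f := fun l => frobNorm (covDer (Γt t) i
          (fun y => covDer (Γt t) j (fun z => curv (Γt t) k l z) y) x))
          (fun i => frobNorm_nonneg _) l
    linarith [hp t ht x, n0 t x, n1 t x]

lemma covDer_Jv {Γ : Conn n m} (hΓ : Smooth Γ) (i j : Fin n) (x) :
    covDer Γ i (fun y => Jv Γ j y) x
      = ∑ k, covDer Γ i (fun y => covDer Γ k (fun z => curv Γ k j z) y) x := by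
  have hs : ∀ k, SmoothMat fun y => covDer Γ k (fun z => curv Γ k j z) y := fun k =>
    SmoothMat.covDer hΓ (smooth_curv hΓ k j) k
  have h1 : pder i (fun y => Jv Γ j y) x
      = ∑ k, pder i (fun y => covDer Γ k (fun z => curv Γ k j z) y) x := by
    ext a b
    simp only [pder_apply, Jv, Matrix.sum_apply]
    exact pd_sum (fun k => hs k a b) i x
  simp only [covDer] at h1 ⊢
  rw [h1, Finset.sum_add_distrib]
  congr 1
  simp only [Jv, comm, covDer, Finset.mul_sum, Finset.sum_mul, Finset.sum_sub_distrib]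

lemma growth_Jv (hpoly : PolyCurvGrowth2On Γt S) (hJ : IsCompact J) (hJS : J ⊆ S)
    (j : Fin n) : PGM J fun t x => Jv (Γt t) j x :=
  PGM.sum fun i => (growth_all hpoly hJ hJS).2.1 i i j

lemma growth_normSqF (hpoly : PolyCurvGrowth2On Γt S) (hJ : IsCompact J) (hJS : J ⊆ S) : PG J fun t x => normSqF (Γt t) x := by
  simp only [normSqF, frobSq_eq]
  have h := (growth_all hpoly hJ hJS).1
  exact PG.sum fun i => PG.sum fun j => (h i j).inner (h i j)

lemma growth_Wv (hpoly : PolyCurvGrowth2On Γt S) (hJ : IsCompact J) (hJS : J ⊆ S)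
    (x₀ : Fin n → ℝ) (s : ℝ) (i : Fin n) : PG J fun t x => Wv (Γt t) x₀ s i x := by
  have h := (growth_all hpoly hJ hJS).1
  have h' := growth_Jv hpoly hJ hJS
  exact (((PG.const 4).mul (PG.sum fun j => (h i j).inner (h' j))).sub
    ((PG.const (4 * s)).mul (PG.sum fun k => (PG.coord k (x₀ k)).mul
      (PG.sum fun j => (h k j).inner (h i j))))).add
    ((PG.const s).mul ((PG.coord i (x₀ i)).mul
      (PG.sum fun k => PG.sum fun j => (h k j).inner (h k j))))

lemma growth_covDer_Jv (hpoly : PolyCurvGrowth2On Γt S) (hJ : IsCompact J) (hJS : J ⊆ S)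
    (hsm : ∀ t ∈ S, Smooth (Γt t))
    (i j : Fin n) :
    PGM J fun t x => covDer (Γt t) i (fun y => Jv (Γt t) j y) x :=
  PGM.congr (PGM.sum fun k => (growth_all hpoly hJ hJS).2.2 i k k j)
    fun t ht x => covDer_Jv (hsm t (hJS ht)) i j x

lemma growth_dWv (hpoly : PolyCurvGrowth2On Γt S) (hJ : IsCompact J) (hJS : J ⊆ S)
    (hsm : ∀ t ∈ S, Smooth (Γt t))
    (x₀ : Fin n → ℝ) (s : ℝ) (i : Fin n) :
    PG J fun t x => dWv (Γt t) x₀ s i x := by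
  have h := (growth_all hpoly hJ hJS).1
  have hd := (growth_all hpoly hJ hJS).2.1
  have h' := growth_Jv hpoly hJ hJS
  have hd' := growth_covDer_Jv hpoly hJ hJS hsm
  exact (((PG.const 4).mul (PG.sum fun j => ((hd i i j).inner (h' j)).add
      ((h i j).inner (hd' i j)))).sub
    ((PG.const (4 * s)).mul (PG.sum fun k => ((PG.const _).mul
      (PG.sum fun j => (h k j).inner (h i j))).add ((PG.coord k (x₀ k)).mul
      (PG.sum fun j => ((hd i k j).inner (h i j)).add ((h k j).inner (hd i i j))))))).add
    ((PG.const s).mul (((PG.const 1).mul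
      (PG.sum fun k => PG.sum fun j => (h k j).inner (h k j))).add ((PG.coord i (x₀ i)).mul
      (PG.sum fun k => PG.sum fun j =>
        ((hd i k j).inner (h k j)).add ((h k j).inner (hd i k j))))))

lemma growth_Ev (hpoly : PolyCurvGrowth2On Γt S) (hJ : IsCompact J) (hJS : J ⊆ S)
    (hsm : ∀ t ∈ S, Smooth (Γt t))
    (x₀ : Fin n → ℝ) {s : ℝ → ℝ} {M : ℝ} (hs : ∀ t ∈ J, |s t| ≤ M) :
    PG J fun t x => Ev (Γt t) x₀ (s t) x := by
  have h := (growth_all hpoly hJ hJS).1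
  have hd' := growth_covDer_Jv hpoly hJ hJS hsm
  have hst : PG J fun t (_ : Fin n → ℝ) => s t := PG.time M hs
  simp only [Ev, sq]
  exact ((PG.const 4).mul (PG.sum fun i => PG.sum fun j => (h i j).inner (hd' i j))).sub
    (((hst.mul hst).mul (PG.sum fun i => (PG.coord i (x₀ i)).mul (PG.coord i (x₀ i)))).mul
      (growth_normSqF hpoly hJ hJS))

end bounds

lemma sm_normSqF {Γ : Conn n m} (hΓ : Smooth Γ) : Sm fun x => normSqF Γ x := by
  simp only [normSqF, frobSq_eq]
  exact Sm.sum fun i => Sm.sum fun j => Sm.frobInner (smooth_curv hΓ i j) (smooth_curv hΓ i j)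

lemma sm_Ev {Γ : Conn n m} (hΓ : Smooth Γ) (x₀ : Fin n → ℝ) (s : ℝ) : Sm fun x => Ev Γ x₀ s x := by
  simp only [Ev, sq (_ - _)]
  exact ((Sm.const 4).mul (Sm.sum fun i => Sm.sum fun j => Sm.frobInner (smooth_curv hΓ i j)
    (SmoothMat.covDer hΓ (smooth_Jv hΓ j) i))).sub
    (((Sm.const (s ^ 2)).mul (Sm.sum fun i => (Sm.coord i (x₀ i)).mul (Sm.coord i (x₀ i)))).mul
      (sm_normSqF hΓ))

/-- The integrated inequality at a fixed time. -/
lemma integral_ineq {Γt : ℝ → Conn n m} {S : Set ℝ} (hpoly : PolyCurvGrowth2On Γt S)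
    (hsm : ∀ t ∈ S, Smooth (Γt t)) {t : ℝ} (ht : t ∈ S) (hmc : MetricCompat (Γt t))
    (x₀ : Fin n → ℝ) {s : ℝ} (hs : 0 < s) :
    (∫ x, Ev (Γt t) x₀ s x * gw x₀ s x)
      - (4 - n) * s * ∫ x, normSqF (Γt t) x * gw x₀ s x ≤ 0 := by
  have hJ : IsCompact ({t} : Set ℝ) := isCompact_singleton
  have hJS : ({t} : Set ℝ) ⊆ S := by simpa using ht
  have htJ : t ∈ ({t} : Set ℝ) := rfl
  have hΓ := hsm t ht
  have I1 : Integrable fun x => Ev (Γt t) x₀ s x * gw x₀ s x :=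
    PG.integrable x₀ hs (growth_Ev hpoly hJ hJS hsm x₀ (s := fun _ => s) (M := |s|)
      fun _ _ => le_rfl) htJ (sm_Ev hΓ x₀ s).cont
  have I2 : Integrable fun x => normSqF (Γt t) x * gw x₀ s x :=
    PG.integrable x₀ hs (growth_normSqF hpoly hJ hJS) htJ (sm_normSqF hΓ).cont
  have h3 : ∀ i, Integrable (fun x => (dWv (Γt t) x₀ s i x
        - s * (x i - x₀ i) * Wv (Γt t) x₀ s i x) * gw x₀ s x) ∧
      ∫ x, (dWv (Γt t) x₀ s i x - s * (x i - x₀ i) * Wv (Γt t) x₀ s i x) * gw x₀ s x = 0 := by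
    intro i
    have hg : PG {t} fun t => pd i ((fun t x => Wv (Γt t) x₀ s i x) t) := by
      refine (growth_dWv hpoly hJ hJS hsm x₀ s i).mono' fun t' ht' x => ?_
      rw [Set.mem_singleton_iff] at ht'
      subst ht'
      exact (congrArg abs (pd_Wv hΓ hmc x₀ s i x)).le
    have := gauss_ibp x₀ hs htJ i (f := fun t x => Wv (Γt t) x₀ s i x) (sm_Wv hΓ x₀ s i)
      (growth_Wv hpoly hJ hJS x₀ s i) hg
    have e : ∀ x, pd i (fun x => Wv (Γt t) x₀ s i x) x = dWv (Γt t) x₀ s i x := fun x =>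
      pd_Wv hΓ hmc x₀ s i x
    simpa only [e] using this
  rw [← integral_const_mul, ← integral_sub I1 (I2.const_mul _)]
  have h4 : ∫ x, ∑ i, (dWv (Γt t) x₀ s i x
      - s * (x i - x₀ i) * Wv (Γt t) x₀ s i x) * gw x₀ s x = 0 := by
    rw [integral_finsetSum _ fun i _ => (h3 i).1]
    exact Finset.sum_eq_zero fun i _ => (h3 i).2
  rw [← h4]
  refine integral_mono (I1.sub (I2.const_mul _)) (integrable_finsetSum _ fun i _ => (h3 i).1) ?_
  intro x
  have := mul_le_mul_of_nonneg_right (key_pointwise hΓ x₀ s x) (gw_pos x₀ s x).le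
  simp only
  rw [← Finset.sum_mul]
  linarith

end families

end YM

namespace YM

section timeDerivative

variable {n m : ℕ}

lemma fderiv_slice {E : Type*} [NormedAddCommGroup E] [NormedSpace ℝ E] {g : ℝ × E → ℝ}
    {t : ℝ} {x : E} (h : DifferentiableAt ℝ g (t, x)) (v : E) :
    fderiv ℝ (fun y => g (t, y)) x v = fderiv ℝ g (t, x) (0, v) := by
  have h1 : HasFDerivAt (fun y : E => (t, y)) (ContinuousLinearMap.inr ℝ ℝ E) x :=
    hasFDerivAt_prodMk_right t x
  have h2 := h.hasFDerivAt.comp x h1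
  have h3 : fderiv ℝ (fun y => g (t, y)) x
      = (fderiv ℝ g (t, x)).comp (ContinuousLinearMap.inr ℝ ℝ E) := h2.fderiv
  rw [h3]; rfl

lemma hasDerivAt_slice {E : Type*} [NormedAddCommGroup E] [NormedSpace ℝ E] {F : Type*}
    [NormedAddCommGroup F] [NormedSpace ℝ F] {g : ℝ × E → F}
    {t : ℝ} {x : E} (h : DifferentiableAt ℝ g (t, x)) :
    HasDerivAt (fun t' => g (t', x)) (fderiv ℝ g (t, x) (1, 0)) t := by
  have h1 : HasFDerivAt (fun t' : ℝ => (t', x)) (ContinuousLinearMap.inl ℝ ℝ E) t :=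
    hasFDerivAt_prodMk_left t x
  have h2 := (h.hasFDerivAt.comp t h1).hasDerivAt
  refine HasDerivAt.congr_deriv (f := fun t' => g (t', x)) h2 ?_
  simp

/-- Exchange of the time derivative with a space derivative. -/
lemma hasDerivAt_fderiv_slice {E : Type*} [NormedAddCommGroup E] [NormedSpace ℝ E]
    {g : ℝ × E → ℝ} {a b : ℝ} (hg : ContDiffOn ℝ (⊤ : ℕ∞) g (Set.Ioo a b ×ˢ Set.univ))
    {h : ℝ → E → ℝ} (hh : ∀ t ∈ Set.Ioo a b, ∀ x, HasDerivAt (fun t' => g (t', x)) (h t x) t)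
    {t : ℝ} (ht : t ∈ Set.Ioo a b) (x v : E) :
    HasDerivAt (fun t' => fderiv ℝ (fun y => g (t', y)) x v) (fderiv ℝ (h t) x v) t := by
  have hU : IsOpen (Set.Ioo a b ×ˢ (Set.univ : Set E)) := isOpen_Ioo.prod isOpen_univ
  have hcd : ∀ t ∈ Set.Ioo a b, ∀ x, ContDiffAt ℝ (⊤ : ℕ∞) g (t, x) := fun t ht x =>
    hg.contDiffAt (hU.mem_nhds ⟨ht, trivial⟩)
  have hd : ∀ t ∈ Set.Ioo a b, ∀ x, DifferentiableAt ℝ g (t, x) := fun t ht x =>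
    (hcd t ht x).differentiableAt (by simp)
  have hd2 : ∀ t ∈ Set.Ioo a b, ∀ x, DifferentiableAt ℝ (fderiv ℝ g) (t, x) := fun t ht x =>
    ((hcd t ht x).fderiv_right (m := (⊤ : ℕ∞)) (by simp)).differentiableAt (by simp)
  have e1 : h t = fun y => fderiv ℝ g (t, y) (1, 0) := by
    funext y
    exact (hh t ht y).unique (hasDerivAt_slice (hd t ht y))
  have e2 : (fun t' => fderiv ℝ (fun y => g (t', y)) x v) =ᶠ[nhds t]
      fun t' => fderiv ℝ g (t', x) (0, v) := by
    filter_upwards [isOpen_Ioo.mem_nhds ht] with t' ht'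
    exact fderiv_slice (hd t' ht' x) v
  have e3 : fderiv ℝ (h t) x v = fderiv ℝ (fderiv ℝ g) (t, x) (0, v) (1, 0) := by
    rw [e1]
    have hp : HasFDerivAt (fun p => fderiv ℝ g p (1, 0))
        ((ContinuousLinearMap.apply ℝ ℝ ((1 : ℝ), (0 : E))).comp (fderiv ℝ (fderiv ℝ g) (t, x)))
        (t, x) :=
      (ContinuousLinearMap.hasFDerivAt
        (ContinuousLinearMap.apply ℝ ℝ ((1 : ℝ), (0 : E)))).comp (t, x) (hd2 t ht x).hasFDerivAt
    rw [fderiv_slice (g := fun p => fderiv ℝ g p (1, 0)) hp.differentiableAt, hp.fderiv]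
    rfl
  have hmin : minSmoothness ℝ 2 ≤ ((⊤ : ℕ∞) : WithTop ℕ∞) := by
    simp only [minSmoothness_of_isRCLikeNormedField]
    exact WithTop.coe_le_coe.2 (le_top (a := (2:ℕ∞)))
  have hs : fderiv ℝ (fderiv ℝ g) (t, x) (0, v) (1, 0)
      = fderiv ℝ (fderiv ℝ g) (t, x) (1, 0) (0, v) :=
    (hcd t ht x).isSymmSndFDerivAt hmin _ _
  rw [e3, hs]
  refine HasDerivAt.congr_of_eventuallyEq ?_ e2
  have := hasDerivAt_slice (g := fderiv ℝ g) (hd2 t ht x)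
  have h4 := ((ContinuousLinearMap.apply ℝ ℝ ((0 : ℝ), v)).hasFDerivAt
    (x := fderiv ℝ g (t, x))).comp_hasDerivAt t this
  exact h4

lemma continuousOn_fderiv_slice {E : Type*} [NormedAddCommGroup E] [NormedSpace ℝ E]
    {g : ℝ × E → ℝ} {a b : ℝ} (hab : a < b)
    (hg : ContDiffOn ℝ (⊤ : ℕ∞) g (Set.Ico a b ×ˢ Set.univ)) (x v : E) :
    ContinuousOn (fun t' => fderiv ℝ (fun y => g (t', y)) x v) (Set.Ico a b) := by
  set T : Set (ℝ × E) := Set.Ico a b ×ˢ Set.univ with hT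
  have hu : UniqueDiffOn ℝ T :=
    ((convex_Ico a b).prod convex_univ : Convex ℝ T) |> fun hc =>
      uniqueDiffOn_convex hc (by
        rw [interior_prod_eq, interior_Ico, interior_univ]
        exact (Set.nonempty_Ioo.2 hab).prod Set.univ_nonempty)
  have hc := hg.continuousOn_fderivWithin hu (by simp)
  have e : ∀ t ∈ Set.Ico a b, fderiv ℝ (fun y => g (t, y)) x v
      = fderivWithin ℝ g T (t, x) (0, v) := by
    intro t ht
    have hd : HasFDerivWithinAt g (fderivWithin ℝ g T (t, x)) T (t, x) :=
      (hg.differentiableOn (by simp) (t, x) ⟨ht, trivial⟩).hasFDerivWithinAt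
    have h1 : HasFDerivAt (fun y : E => (t, y)) (ContinuousLinearMap.inr ℝ ℝ E) x :=
      hasFDerivAt_prodMk_right t x
    have h2 : HasFDerivWithinAt (fun y => g (t, y))
        ((fderivWithin ℝ g T (t, x)).comp (ContinuousLinearMap.inr ℝ ℝ E)) Set.univ x :=
      hd.comp (f := fun y : E => (t, y)) x h1.hasFDerivWithinAt (fun y _ => ⟨ht, trivial⟩)
    rw [(hasFDerivWithinAt_univ.1 h2).fderiv]; rfl
  refine ContinuousOn.congr ?_ e
  have h3 : ContinuousOn (fun t : ℝ => fderivWithin ℝ g T (t, x)) (Set.Ico a b) :=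
    hc.comp (f := fun t : ℝ => (t, x)) (by fun_prop) (fun t ht => ⟨ht, trivial⟩)
  exact h3.clm_apply continuousOn_const

variable {Γt : ℝ → Conn n m} {α β : ℝ}

lemma smooth_at_time (hsm : SmoothFamilyOn Γt (Set.Ico α β)) :
    ∀ t ∈ Set.Ico α β, Smooth (Γt t) := by
  intro t ht i a b
  have h := (hsm i a b).comp (g := fun p : ℝ × (Fin n → ℝ) => Γt p.1 p.2 i a b)
    (f := fun y : Fin n → ℝ => (t, y)) (s := Set.univ)
    (by fun_prop) (fun y _ => ⟨ht, trivial⟩)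
  exact contDiffOn_univ.1 h

lemma flow_deriv (hflow : YMFlowOn Γt (Set.Ico α β)) {t : ℝ} (ht : t ∈ Set.Ioo α β)
    (x : Fin n → ℝ) (k a b) :
    HasDerivAt (fun t' => Γt t' x k a b) (Jv (Γt t) k x a b) t :=
  (hflow t ⟨ht.1.le, ht.2⟩ x k a b).hasDerivAt (Ico_mem_nhds ht.1 ht.2)

lemma pder_deriv (hsm : SmoothFamilyOn Γt (Set.Ico α β)) (hflow : YMFlowOn Γt (Set.Ico α β))
    {t : ℝ} (ht : t ∈ Set.Ioo α β) (x : Fin n → ℝ) (i k a b) :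
    HasDerivAt (fun t' => pder i (fun y => Γt t' y k) x a b)
      (pder i (fun y => Jv (Γt t) k y) x a b) t := by
  have hg : ContDiffOn ℝ (⊤ : ℕ∞) (fun p : ℝ × (Fin n → ℝ) => Γt p.1 p.2 k a b)
      (Set.Ioo α β ×ˢ Set.univ) :=
    (hsm k a b).mono (Set.prod_mono Set.Ioo_subset_Ico_self le_rfl)
  exact hasDerivAt_fderiv_slice hg (h := fun t x => Jv (Γt t) k x a b)
    (fun t ht x => flow_deriv hflow ht x k a b) ht x (Pi.single i 1)

lemma hasDerivAt_matmul {A B : ℝ → Matrix (Fin m) (Fin m) ℝ} {A' B' : Matrix (Fin m) (Fin m) ℝ}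
    {t : ℝ} (hA : ∀ a b, HasDerivAt (fun t => A t a b) (A' a b) t)
    (hB : ∀ a b, HasDerivAt (fun t => B t a b) (B' a b) t) (a b) :
    HasDerivAt (fun t => (A t * B t) a b) ((A' * B t + A t * B') a b) t := by
  simp only [Matrix.mul_apply, Matrix.add_apply, ← Finset.sum_add_distrib]
  exact HasDerivAt.fun_sum fun c _ => (hA a c).mul (hB c b)

lemma curv_deriv (hsm : SmoothFamilyOn Γt (Set.Ico α β)) (hflow : YMFlowOn Γt (Set.Ico α β))
    {t : ℝ} (ht : t ∈ Set.Ioo α β) (x : Fin n → ℝ) (i j a b) :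
    HasDerivAt (fun t' => curv (Γt t') i j x a b)
      ((covDer (Γt t) i (fun y => Jv (Γt t) j y) x
        - covDer (Γt t) j (fun y => Jv (Γt t) i y) x) a b) t := by
  have hp := pder_deriv hsm hflow ht x
  have hf := flow_deriv hflow ht x
  have h1 := hasDerivAt_matmul (hf i) (hf j) a b
  have h2 := hasDerivAt_matmul (hf j) (hf i) a b
  have h := ((hp i j a b).sub (hp j i a b)).add (h1.sub h2)
  refine h.congr_deriv ?_
  simp only [covDer, comm, Matrix.sub_apply, Matrix.add_apply]
  ring

lemma normSqF_deriv (hsm : SmoothFamilyOn Γt (Set.Ico α β)) (hflow : YMFlowOn Γt (Set.Ico α β))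
    {t : ℝ} (ht : t ∈ Set.Ioo α β) (x : Fin n → ℝ) :
    HasDerivAt (fun t' => normSqF (Γt t') x)
      (4 * ∑ i, ∑ j, frobInner (curv (Γt t) i j x)
        (covDer (Γt t) i (fun y => Jv (Γt t) j y) x)) t := by
  have h : HasDerivAt (fun t' => normSqF (Γt t') x)
      (∑ i, ∑ j, ∑ a, ∑ b, 2 * (curv (Γt t) i j x a b *
        (covDer (Γt t) i (fun y => Jv (Γt t) j y) x
        - covDer (Γt t) j (fun y => Jv (Γt t) i y) x) a b)) t := by
    unfold normSqF frobSq
    refine HasDerivAt.fun_sum fun i _ => HasDerivAt.fun_sum fun j _ =>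
      HasDerivAt.fun_sum fun a _ => HasDerivAt.fun_sum fun b _ => ?_
    refine ((curv_deriv hsm hflow ht x i j a b).pow 2).congr_deriv ?_
    simp; ring
  refine h.congr_deriv ?_
  set F := fun i j => curv (Γt t) i j x with hF
  set E := fun i j => covDer (Γt t) i (fun y => Jv (Γt t) j y) x with hE
  have hFa : ∀ i j, F i j = - F j i := fun i j => curv_antisymm _ i j x
  have h1 : ∀ i j, ∑ a, ∑ b, 2 * (F i j a b * (E i j - E j i) a b)
      = 2 * frobInner (F i j) (E i j) + 2 * frobInner (F j i) (E j i) := by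
    intro i j
    have : frobInner (F j i) (E j i) = - frobInner (F i j) (E j i) := by
      rw [hFa j i, frobInner_neg_left]
    rw [this, ← mul_add, ← sub_eq_add_neg, ← frobInner_sub_right]
    simp only [frobInner, Finset.mul_sum]
  change ∑ i, ∑ j, ∑ a, ∑ b, 2 * (F i j a b * (E i j - E j i) a b)
    = 4 * ∑ i, ∑ j, frobInner (F i j) (E i j)
  have h2 : ∑ i, ∑ j, frobInner (F j i) (E j i) = ∑ i, ∑ j, frobInner (F i j) (E i j) :=
    Finset.sum_comm
  simp only [h1]
  simp only [Finset.sum_add_distrib, ← Finset.mul_sum]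
  rw [h2]
  ring

lemma normSqF_cont (hαβ : α < β) (hsm : SmoothFamilyOn Γt (Set.Ico α β)) (x : Fin n → ℝ) :
    ContinuousOn (fun t' => normSqF (Γt t') x) (Set.Ico α β) := by
  have hp : ∀ i k a b, ContinuousOn (fun t' => pder i (fun y => Γt t' y k) x a b)
      (Set.Ico α β) := fun i k a b =>
    continuousOn_fderiv_slice (g := fun p : ℝ × (Fin n → ℝ) => Γt p.1 p.2 k a b) hαβ
      (hsm k a b) x (Pi.single i 1)
  have hf : ∀ k a b, ContinuousOn (fun t' => Γt t' x k a b) (Set.Ico α β) := fun k a b =>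
    (hsm k a b).continuousOn.comp (f := fun t : ℝ => (t, x)) (by fun_prop)
      (fun t ht => ⟨ht, trivial⟩)
  have hm : ∀ i j a b, ContinuousOn (fun t' => (Γt t' x i * Γt t' x j) a b) (Set.Ico α β) := by
    intro i j a b
    simp only [Matrix.mul_apply]
    exact continuousOn_finsetSum _ fun c _ => (hf i a c).mul (hf j c b)
  unfold normSqF frobSq
  refine continuousOn_finsetSum _ fun i _ => continuousOn_finsetSum _ fun j _ =>
    continuousOn_finsetSum _ fun a _ => continuousOn_finsetSum _ fun b _ => ?_
  exact (((hp i j a b).sub (hp j i a b)).add ((hm i j a b).sub (hm j i a b))).pow 2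

end timeDerivative

end YM

namespace YM

section final

variable {n m : ℕ}

lemma hasDerivAt_sv {t₀ t : ℝ} (ht : t < t₀) :
    HasDerivAt (fun t' => 1 / (2 * (t₀ - t'))) (2 * (1 / (2 * (t₀ - t))) ^ 2) t := by
  have h0 : t₀ - t ≠ 0 := by linarith
  have h1 : HasDerivAt (fun t' : ℝ => 2 * (t₀ - t')) (-2) t := by
    simpa using ((hasDerivAt_id t).const_sub t₀).const_mul 2
  have h2 := h1.inv (mul_ne_zero two_ne_zero h0)
  simp only [one_div]
  refine HasDerivAt.congr_deriv (f := fun t' => (2 * (t₀ - t'))⁻¹) h2 ?_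
  field_simp

lemma sv_mono {t₀ a b : ℝ} (hab : a ≤ b) (hb : b < t₀) :
    1 / (2 * (t₀ - a)) ≤ 1 / (2 * (t₀ - b)) :=
  one_div_le_one_div_of_le (by linarith) (by linarith)

lemma sv_pos {t₀ b : ℝ} (hb : b < t₀) : 0 < 1 / (2 * (t₀ - b)) := by
  have : 0 < t₀ - b := by linarith
  positivity

lemma hasDerivAt_gw (x₀ x : Fin n → ℝ) {t₀ t : ℝ} (ht : t < t₀) :
    HasDerivAt (fun t' => gw x₀ (1 / (2 * (t₀ - t'))) x)
      (-((1 / (2 * (t₀ - t))) ^ 2 * ∑ i, (x i - x₀ i) ^ 2) * gw x₀ (1 / (2 * (t₀ - t))) x) t := by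
  have h := ((((hasDerivAt_sv ht).div_const 2).mul_const (∑ i, (x i - x₀ i) ^ 2)).neg).exp
  refine HasDerivAt.congr_deriv (f := fun t' => gw x₀ (1 / (2 * (t₀ - t'))) x) h ?_
  simp only [gw, Pi.neg_apply]
  ring

lemma hasDerivAt_cv (n : ℕ) {t₀ t : ℝ} (ht : t < t₀) :
    HasDerivAt (fun t' => (t₀ - t') ^ 2 * (4 * Real.pi * (t₀ - t')) ^ (-(n : ℝ) / 2))
      (-((4 - n) * (1 / (2 * (t₀ - t)))
        * ((t₀ - t) ^ 2 * (4 * Real.pi * (t₀ - t)) ^ (-(n : ℝ) / 2)))) t := by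
  have h0 : 0 < t₀ - t := by linarith
  have hpi := Real.pi_pos
  have hp : 0 < 4 * Real.pi * (t₀ - t) := by positivity
  have h1 : HasDerivAt (fun t' : ℝ => t₀ - t') (-1) t := by
    simpa using (hasDerivAt_id t).const_sub t₀
  have h2 := (h1.const_mul (4 * Real.pi)).rpow_const (p := -(n : ℝ) / 2) (Or.inl hp.ne')
  have h3 := (h1.pow 2).mul h2
  refine HasDerivAt.congr_deriv
    (f := fun t' => (t₀ - t') ^ 2 * (4 * Real.pi * (t₀ - t')) ^ (-(n : ℝ) / 2)) h3 ?_
  rw [Real.rpow_sub_one hp.ne']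
  simp only [Pi.pow_apply]
  field_simp
  ring

variable {Γt : ℝ → Conn n m} {α β : ℝ}

lemma hasDerivAt_integrand (hsm : SmoothFamilyOn Γt (Set.Ico α β))
    (hflow : YMFlowOn Γt (Set.Ico α β)) (x₀ x : Fin n → ℝ) {t₀ t : ℝ} (ht : t ∈ Set.Ioo α β)
    (ht' : t < t₀) :
    HasDerivAt (fun t' => normSqF (Γt t') x * gw x₀ (1 / (2 * (t₀ - t'))) x)
      (Ev (Γt t) x₀ (1 / (2 * (t₀ - t))) x * gw x₀ (1 / (2 * (t₀ - t))) x) t := by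
  refine ((normSqF_deriv hsm hflow ht x).mul (hasDerivAt_gw x₀ x ht')).congr_deriv ?_
  simp only [Ev]
  ring

lemma hasDerivAt_I (hsm : SmoothFamilyOn Γt (Set.Ico α β))
    (hflow : YMFlowOn Γt (Set.Ico α β)) (hpoly : PolyCurvGrowth2On Γt (Set.Ico α β))
    (x₀ : Fin n → ℝ) {t₀ t : ℝ} (ht : t ∈ Set.Ioo α β) (ht' : t < t₀) :
    HasDerivAt (fun t' => ∫ x, normSqF (Γt t') x * gw x₀ (1 / (2 * (t₀ - t'))) x)
      (∫ x, Ev (Γt t) x₀ (1 / (2 * (t₀ - t))) x * gw x₀ (1 / (2 * (t₀ - t))) x) t := by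
  obtain ⟨a, ha1, ha2⟩ := exists_between ht.1
  obtain ⟨b, hb1, hb2⟩ := exists_between (lt_min ht.2 ht')
  have hbβ : b < β := hb2.trans_le (min_le_left _ _)
  have hbt : b < t₀ := hb2.trans_le (min_le_right _ _)
  have hJS : Set.Icc a b ⊆ Set.Ico α β := fun u hu => ⟨ha1.le.trans hu.1, hu.2.trans_lt hbβ⟩
  have hst := smooth_at_time hsm
  have htJ : t ∈ Set.Icc a b := ⟨ha2.le, hb1.le⟩
  have hb : ∀ u ∈ Set.Icc a b, |1 / (2 * (t₀ - u))| ≤ 1 / (2 * (t₀ - b)) := fun u hu => by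
    rw [abs_of_pos (sv_pos (hu.2.trans_lt hbt))]
    exact sv_mono hu.2 hbt
  obtain ⟨C, hC, N, hN⟩ := growth_Ev hpoly isCompact_Icc hJS hst x₀ (s := fun u => 1 / (2 * (t₀ - u))) hb
  refine (hasDerivAt_integral_of_dominated_loc_of_deriv_le (s := Set.Icc a b)
    (F := fun t' x => normSqF (Γt t') x * gw x₀ (1 / (2 * (t₀ - t'))) x)
    (F' := fun t' x => Ev (Γt t') x₀ (1 / (2 * (t₀ - t'))) x * gw x₀ (1 / (2 * (t₀ - t'))) x)
    (bound := fun x => C * (1 + ‖x‖) ^ N * gw x₀ (1 / (2 * (t₀ - a))) x)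
    (Icc_mem_nhds ha2 hb1) ?_ ?_ ?_ ?_ ?_ ?_).2
  · filter_upwards [Icc_mem_nhds ha2 hb1] with u hu
    exact ((sm_normSqF (hst u (hJS hu))).cont.mul (sm_gw x₀ _).cont).aestronglyMeasurable
  · exact (growth_normSqF hpoly isCompact_Icc hJS).integrable x₀ (sv_pos ht') htJ
      (sm_normSqF (hst t (hJS htJ))).cont
  · exact ((sm_Ev (hst t (hJS htJ)) x₀ _).cont.mul (sm_gw x₀ _).cont).aestronglyMeasurable
  · refine Eventually.of_forall fun x u hu => ?_
    rw [norm_mul, Real.norm_of_nonneg (gw_pos _ _ _).le]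
    exact mul_le_mul (hN u hu x) (gw_mono x₀ (sv_mono hu.1 (hu.2.trans_lt hbt)) x)
      (gw_pos _ _ _).le (by positivity)
  · exact integrable_poly_gw x₀ (sv_pos (ha2.trans ht')) C N
  · exact Eventually.of_forall fun x u hu => hasDerivAt_integrand hsm hflow x₀ x
      ⟨ha1.trans_le hu.1, hu.2.trans_lt hbβ⟩ (hu.2.trans_lt hbt)

lemma continuousOn_I (hαβ : α < β) (hsm : SmoothFamilyOn Γt (Set.Ico α β))
    (hpoly : PolyCurvGrowth2On Γt (Set.Ico α β)) (x₀ : Fin n → ℝ) {t₀ : ℝ} :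
    ContinuousOn (fun t' => ∫ x, normSqF (Γt t') x * gw x₀ (1 / (2 * (t₀ - t'))) x)
      (Set.Ico α (min t₀ β)) := by
  intro t ht
  obtain ⟨b, hb1, hb2⟩ := exists_between ht.2
  have hbβ : b < β := hb2.trans_le (min_le_right _ _)
  have hbt : b < t₀ := hb2.trans_le (min_le_left _ _)
  have hJS : Set.Icc α b ⊆ Set.Ico α β := fun u hu => ⟨hu.1, hu.2.trans_lt hbβ⟩
  have hst := smooth_at_time hsm
  obtain ⟨C, hC, N, hN⟩ := growth_normSqF hpoly isCompact_Icc hJS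
  have hev : ∀ᶠ u in nhdsWithin t (Set.Ico α (min t₀ β)), u ∈ Set.Icc α b := by
    filter_upwards [self_mem_nhdsWithin, mem_nhdsWithin_of_mem_nhds (Iio_mem_nhds hb1)] with u hu hu'
    exact ⟨hu.1, le_of_lt hu'⟩
  refine continuousWithinAt_of_dominated
    (bound := fun x => C * (1 + ‖x‖) ^ N * gw x₀ (1 / (2 * (t₀ - α))) x) ?_ ?_ ?_ ?_
  · filter_upwards [hev] with u hu
    exact ((sm_normSqF (hst u (hJS hu))).cont.mul (sm_gw x₀ _).cont).aestronglyMeasurable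
  · filter_upwards [hev] with u hu
    refine Eventually.of_forall fun x => ?_
    rw [norm_mul, Real.norm_of_nonneg (gw_pos _ _ _).le]
    exact mul_le_mul (hN u hu x) (gw_mono x₀ (sv_mono hu.1 (hu.2.trans_lt hbt)) x)
      (gw_pos _ _ _).le (by positivity)
  · exact integrable_poly_gw x₀ (sv_pos (ht.1.trans_lt (hb1.trans hbt))) C N
  · refine Eventually.of_forall fun x => ?_
    have h1 : ContinuousWithinAt (fun t' => normSqF (Γt t') x) (Set.Ico α (min t₀ β)) t :=
      (normSqF_cont hαβ hsm x t ⟨ht.1, hb1.trans hbβ⟩).mono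
        (Set.Ico_subset_Ico_right (min_le_right _ _))
    exact h1.mul (hasDerivAt_gw x₀ x (hb1.trans hbt)).continuousAt.continuousWithinAt

end final

end YM

/-- **Monotonicity of the `ℱ`-functional along Yang–Mills flow**
(Proposition `monform`, shrinker case): along a Yang–Mills flow on
`[α, β)` with locally-in-time polynomial curvature growth, the function
`t ↦ (t₀−t)² (4π(t₀−t))^{−n/2} ∫ |F_t|² e^{−|x−x₀|²/(4(t₀−t))}` is
nonincreasing on `[α, t₀) ∩ [α, β)`. -/
theorem Ffunctional_monotone (n m : ℕ) (α β : ℝ) (hαβ : α < β)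
    (Γt : ℝ → YM.Conn n m)
    (hsm : YM.SmoothFamilyOn Γt (Set.Ico α β))
    (hmc : ∀ t ∈ Set.Ico α β, YM.MetricCompat (Γt t))
    (hflow : YM.YMFlowOn Γt (Set.Ico α β))
    (hpoly : YM.PolyCurvGrowth2On Γt (Set.Ico α β))
    (x₀ : Fin n → ℝ) (t₀ : ℝ) (ht₀l : α < t₀) (ht₀r : t₀ ≤ β) :
    AntitoneOn (fun t =>
        (t₀ - t) ^ 2 * (4 * Real.pi * (t₀ - t)) ^ (-(n : ℝ) / 2) *
          ∫ x : Fin n → ℝ, YM.normSqF (Γt t) x *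
            Real.exp (-(∑ i, (x i - x₀ i) ^ 2) / (4 * (t₀ - t))))
      (Set.Ico α (min t₀ β)) := by
  have key : ∀ t x, Real.exp (-(∑ i, (x i - x₀ i) ^ 2) / (4 * (t₀ - t)))
      = YM.gw x₀ (1 / (2 * (t₀ - t))) x := by
    intro t x
    simp only [YM.gw]
    congr 1
    rcases eq_or_ne (t₀ - t) 0 with h | h
    · simp [h]
    · field_simp
      ring
  simp only [key]
  refine antitoneOn_of_hasDerivWithinAt_nonpos (convex_Ico _ _)
    (f' := fun t => (t₀ - t) ^ 2 * (4 * Real.pi * (t₀ - t)) ^ (-(n : ℝ) / 2) *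
      ((∫ x, YM.Ev (Γt t) x₀ (1 / (2 * (t₀ - t))) x * YM.gw x₀ (1 / (2 * (t₀ - t))) x)
      - (4 - n) * (1 / (2 * (t₀ - t))) *
        ∫ x, YM.normSqF (Γt t) x * YM.gw x₀ (1 / (2 * (t₀ - t))) x)) ?_ ?_ ?_
  · refine ContinuousOn.mul (fun t ht => ?_) (YM.continuousOn_I hαβ hsm hpoly x₀)
    exact (YM.hasDerivAt_cv n (ht.2.trans_le (min_le_left _ _))).continuousAt.continuousWithinAt
  · intro t ht
    rw [interior_Ico] at ht
    have h1 : t < t₀ := ht.2.trans_le (min_le_left _ _)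
    have h2 : t < β := ht.2.trans_le (min_le_right _ _)
    refine (((YM.hasDerivAt_cv n h1).mul
      (YM.hasDerivAt_I hsm hflow hpoly x₀ ⟨ht.1, h2⟩ h1)).congr_deriv ?_).hasDerivWithinAt
    ring
  · intro t ht
    rw [interior_Ico] at ht
    have h1 : t < t₀ := ht.2.trans_le (min_le_left _ _)
    have h2 : t < β := ht.2.trans_le (min_le_right _ _)
    have htS : t ∈ Set.Ico α β := ⟨ht.1.le, h2⟩
    have h0 : 0 < t₀ - t := by linarith
    have hpi := Real.pi_pos
    exact mul_nonpos_of_nonneg_of_nonpos (by positivity)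
      (YM.integral_ineq hpoly (YM.smooth_at_time hsm) htS (hmc t htS) x₀ (YM.sv_pos h1))
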